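/- arXiv:1207.0287 — 6 statements merged into one kernel-verified Lean document; each statement's English description precedes it below -/
import Mathlib

section
/- Let p and q be odd prime numbers with q = p + 2 such that the Legendre symbols satisfy (-7/p) = (-7/q) = -1. Let α ∈ ℚ₂ satisfy α² = -7 and have 2-adic valuation v₂(1+α) = 1, and set π = -(1+α)/2 (so π is a 2-adic unit). Then there exist z, w ∈ ℚ₂ such that w² = π - 2(p+q)z² + (4/π)z⁴. -/
/-- Let `p` and `q` be odd primes with `q = p + 2` and `(-7/p) = (-7/q) = -1`. Let
`α ∈ ℚ₂` with `α² = -7` and `v₂(1+α) = 1`, and set `π = -(1+α)/2`. Then there exist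
`z, w ∈ ℚ₂` with `w² = π - 2(p+q)z² + (4/π)z⁴`. -/
theorem stmt_3 (p q : ℕ) [Fact p.Prime] [Fact q.Prime] (hpo : Odd p) (hqo : Odd q)
    (hpq : q = p + 2) (hA : legendreSym p (-7) = -1 ∧ legendreSym q (-7) = -1)
    (α : ℚ_[2]) (hα : α ^ 2 = -7) (hval : (1 + α).valuation = 1)
    (π : ℚ_[2]) (hπ : π = -(1 + α) / 2) :
    ∃ z w : ℚ_[2],
      w ^ 2 = π - 2 * ((p : ℚ_[2]) + (q : ℚ_[2])) * z ^ 2 + (4 / π) * z ^ 4 := by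
  have h0 : (1 + α) ≠ 0 := by
    intro h
    rw [h] at hval
    simp at hval
  have h2 : ‖(2 : ℚ_[2])‖ = 2⁻¹ := by
    simpa using Padic.norm_p (p := 2)
  have hn : ‖1 + α‖ = 2⁻¹ := by
    rw [Padic.norm_eq_zpow_neg_valuation h0, hval]
    simp
  have hπn : ‖π‖ = 1 := by
    rw [hπ, norm_div, norm_neg, hn, h2]
    norm_num
  have hπ0 : π ≠ 0 := by
    intro h
    simp [h] at hπn
  have hq : π ^ 2 + π + 2 = 0 := by
    rw [hπ]
    linear_combination hα / 4
  obtain ⟨k, hk⟩ := hpo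
  let u : ℤ_[2] := ⟨π, hπn.le⟩
  have hu : ‖u‖ = 1 := hπn
  have h2' : ‖(2 : ℤ_[2])‖ = 2⁻¹ := by
    simpa using PadicInt.norm_p (p := 2)
  let F : Polynomial ℤ_[2] :=
    Polynomial.X ^ 2 - Polynomial.C (u ^ 2 - 2 ^ 3 * ((k : ℤ_[2]) + 1))
  have hF : ∀ x : ℤ_[2], F.eval x = x ^ 2 - (u ^ 2 - 2 ^ 3 * ((k : ℤ_[2]) + 1)) := by
    intro x
    simp [F]
  have hF' : F.derivative.eval u = 2 * u := by
    simp only [F, Polynomial.derivative_sub, Polynomial.derivative_C, Polynomial.derivative_X_pow]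
    simp
  have hlt : ‖Polynomial.aeval u F‖ < ‖Polynomial.aeval u F.derivative‖ ^ 2 := by
    rw [Polynomial.coe_aeval_eq_eval, hF', hF]
    have e : u ^ 2 - (u ^ 2 - 2 ^ 3 * ((k : ℤ_[2]) + 1)) = 2 ^ 3 * ((k : ℤ_[2]) + 1) := by ring
    rw [e, norm_mul, norm_mul, norm_pow, h2', hu]
    have := PadicInt.norm_le_one ((k : ℤ_[2]) + 1)
    norm_num
    linarith
  obtain ⟨w, hw, -⟩ := hensels_lemma hlt
  rw [Polynomial.coe_aeval_eq_eval, hF] at hw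
  have hw' := congrArg (fun x : ℤ_[2] => (x : ℚ_[2])) hw
  have hw2 : (w : ℚ_[2]) ^ 2 - (π ^ 2 - 2 ^ 3 * ((k : ℚ_[2]) + 1)) = 0 := by
    have e : ((u : ℤ_[2]) : ℚ_[2]) = π := rfl
    rw [← e]
    have e2 : ((2 : ℤ_[2]) : ℚ_[2]) = 2 := rfl
    simpa [e2] using hw'
  refine ⟨1, w, ?_⟩
  have h4 : 4 / π = -2 * (π + 1) := by
    field_simp
    linear_combination 2 * hq
  rw [h4, hpq, hk]
  push_cast
  linear_combination hw2 + hq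
end

section
/- Let D be one of -11, -19, -43, -67, -163, and let p and q be odd prime numbers with q = p + 2 such that the Legendre symbols satisfy (D/p) = (D/q) = -1. Let L be a field equipped with a ℚ₂-algebra structure such that L has dimension 2 as a ℚ₂-vector space, and let α ∈ L satisfy α² = D. Then there are no z, w ∈ L with -w² = 1 + 2(p+q)z² + 4z⁴. -/
theorem key_no_sol {L : Type*} [Field L] (h20 : (2 : L) ≠ 0) (O : Subring L)
    (hsq : ∀ x ∈ O, (∃ y ∈ O, x ^ 2 = 2 * y) → ∃ y ∈ O, x = 2 * y)
    (h1 : ¬ ∃ y ∈ O, (1 : L) = 2 * y)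
    (hgen : ∀ l : L, ∃ n : ℕ, 2 ^ n * l ∈ O) (N z w : L) (hN : N ∈ O)
    (h : -w ^ 2 = 1 + 4 * N * z ^ 2 + 4 * z ^ 4) : False := by
  have h2O : (2 : L) ∈ O := by
    have := O.add_mem O.one_mem O.one_mem
    rwa [one_add_one_eq_two] at this
  have h4O : (4 : L) ∈ O := by
    have := O.add_mem h2O h2O
    rwa [two_add_two_eq_four] at this
  -- minimal exponents
  have hmin : ∀ l : L, l ∈ O ∨ ∃ n : ℕ, 2 ^ (n + 1) * l ∈ O ∧
      ¬ ∃ y ∈ O, 2 ^ (n + 1) * l = 2 * y := by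
    intro l
    classical
    obtain ⟨n, hn, hm⟩ : ∃ n : ℕ, 2 ^ n * l ∈ O ∧ ∀ m < n, ¬ (2 ^ m * l ∈ O) :=
      ⟨Nat.find (hgen l), Nat.find_spec (hgen l), fun m hm => Nat.find_min (hgen l) hm⟩
    cases n with
    | zero => left; simpa using hn
    | succ k =>
      right
      refine ⟨k, hn, ?_⟩
      rintro ⟨y, hy, e⟩
      apply hm k (Nat.lt_succ_self k)
      have : 2 ^ k * l = y := by
        apply mul_left_cancel₀ h20
        rw [← e]; ring
      rwa [this]
  have hroot : ∀ x : L, x ^ 2 ∈ O → x ∈ O := by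
    intro x hx
    rcases hmin x with h | ⟨n, hn, hn'⟩
    · exact h
    · exfalso
      apply hn'
      apply hsq _ hn
      refine ⟨2 ^ (2 * n + 1) * x ^ 2, O.mul_mem (O.pow_mem h2O _) hx, ?_⟩
      ring
  have hkey : ∀ W t r : L, W ∈ O → t ∈ O → r ∈ O → W ^ 2 + t ^ 4 = 4 * r →
      ∃ y ∈ O, t = 2 * y := by
    intro W t r hW ht hr e
    have ht2 := O.pow_mem ht 2
    obtain ⟨s, hs, es⟩ := hsq (W + t ^ 2) (O.add_mem hW ht2)
      ⟨2 * r + W * t ^ 2, O.add_mem (O.mul_mem h2O hr) (O.mul_mem hW ht2), by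
        linear_combination e⟩
    apply hsq _ ht
    apply hsq _ ht2
    refine ⟨r + s * t ^ 2 - s ^ 2, O.sub_mem (O.add_mem hr (O.mul_mem hs ht2))
      (O.pow_mem hs 2), ?_⟩
    apply mul_left_cancel₀ h20
    have eW : W = 2 * s - t ^ 2 := by linear_combination es
    subst eW
    linear_combination e
  rcases hmin z with hz | ⟨n, hn, hn'⟩
  · have hr : -(N * z ^ 2 + z ^ 4) ∈ O :=
      O.neg_mem (O.add_mem (O.mul_mem hN (O.pow_mem hz 2)) (O.pow_mem hz 4))
    have hw : w ∈ O := by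
      apply hroot
      have : w ^ 2 = 4 * (-(N * z ^ 2 + z ^ 4)) - 1 := by linear_combination -h
      rw [this]
      exact O.sub_mem (O.mul_mem h4O hr) O.one_mem
    exact h1 (hkey w 1 _ hw O.one_mem hr (by linear_combination -h))
  · apply hn'
    set t := 2 ^ (n + 1) * z with ht
    have hr : -((4 ^ n) ^ 2 + N * 4 ^ n * t ^ 2) ∈ O :=
      O.neg_mem (O.add_mem (O.pow_mem (O.pow_mem h4O n) 2)
        (O.mul_mem (O.mul_mem hN (O.pow_mem h4O n)) (O.pow_mem hn 2)))
    have e4 : (4 : L) ^ n = (2 ^ n) ^ 2 := by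
      rw [← pow_mul, mul_comm, pow_mul]; norm_num
    have e : (2 * 4 ^ n * w) ^ 2 + t ^ 4 = 4 * (-((4 ^ n) ^ 2 + N * 4 ^ n * t ^ 2)) := by
      rw [ht, pow_succ, e4]
      linear_combination -(4 * ((2 : L) ^ n) ^ 4) * h
    have hW : 2 * 4 ^ n * w ∈ O := by
      apply hroot
      rw [eq_sub_of_add_eq e]
      exact O.sub_mem (O.mul_mem h4O hr) (O.pow_mem hn 4)
    exact hkey _ _ _ hW hn hr e

theorem not_sq_two (D : ℤ) (hD : D % 8 = 5) (a : ℚ_[2]) (ha : a ^ 2 = (D : ℚ_[2])) : False := by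
  have hn : ‖a‖ ≤ 1 := by
    have h : ‖a‖ ^ 2 ≤ 1 := by
      rw [← norm_pow, ha]; exact Padic.norm_int_le_one D
    nlinarith [norm_nonneg a]
  have hz : (show ℤ_[2] from ⟨a, hn⟩) ^ 2 = (D : ℤ_[2]) := by
    apply Subtype.ext
    refine Eq.trans ?_ (ha.trans ?_)
    · exact PadicInt.coe_pow _ _
    · exact (PadicInt.coe_intCast D).symm
  have h8 := congrArg (PadicInt.toZModPow (p := 2) 3) hz
  rw [map_pow, map_intCast] at h8
  have h5 : ((D : ℤ) : ZMod (2 ^ 3)) = 5 := by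
    have : ((D : ℤ) : ZMod (2 ^ 3)) = ((5 : ℤ) : ZMod (2 ^ 3)) := by
      rw [ZMod.intCast_eq_intCast_iff]
      exact hD
    rw [this]; rfl
  rw [h5] at h8
  generalize (PadicInt.toZModPow (p := 2) 3) ⟨a, hn⟩ = b at h8
  revert b
  decide

theorem pad_scale (a : ℚ_[2]) : ∃ n : ℕ, ∀ m ≥ n, ∃ x : ℤ_[2], (x : ℚ_[2]) = 2 ^ m * a := by
  have h2 : ‖(2 : ℚ_[2])‖ = 2⁻¹ := by
    have := Padic.norm_p (p := 2)
    exact_mod_cast this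
  have : 0 < (‖a‖ + 1)⁻¹ := by positivity
  obtain ⟨n, hn⟩ := exists_pow_lt_of_lt_one this (by norm_num : (2⁻¹ : ℝ) < 1)
  refine ⟨n, fun m hm => ⟨⟨2 ^ m * a, ?_⟩, rfl⟩⟩
  rw [norm_mul, norm_pow, h2]
  have h1 : (2⁻¹ : ℝ) ^ m ≤ 2⁻¹ ^ n := pow_le_pow_of_le_one (by norm_num) (by norm_num) hm
  have h3 : (2⁻¹ : ℝ) ^ m ≤ (‖a‖ + 1)⁻¹ := by linarith
  calc (2⁻¹ : ℝ) ^ m * ‖a‖ ≤ (‖a‖ + 1)⁻¹ * (‖a‖ + 1) := by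
        gcongr; linarith
    _ = 1 := inv_mul_cancel₀ (by positivity)

/-- The embedding of `ℤ₂` into `L`. -/
noncomputable def zL (L : Type*) [Field L] [Algebra ℚ_[2] L] : ℤ_[2] →+* L :=
  (algebraMap ℚ_[2] L).comp PadicInt.Coe.ringHom

theorem zL_apply (L : Type*) [Field L] [Algebra ℚ_[2] L] (x : ℤ_[2]) :
    zL L x = algebraMap ℚ_[2] L (x : ℚ_[2]) := rfl

/-- The order `ℤ₂[ω]`. -/
def ordO {L : Type*} [Field L] [Algebra ℚ_[2] L] (c : ℤ) (ω : L) (hω : ω ^ 2 = ω + (c : L)) :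
    Subring L where
  carrier := {l | ∃ x y : ℤ_[2], l = zL L x + zL L y * ω}
  zero_mem' := ⟨0, 0, by simp⟩
  one_mem' := ⟨1, 0, by simp⟩
  add_mem' := by
    rintro _ _ ⟨x, y, rfl⟩ ⟨x', y', rfl⟩
    exact ⟨x + x', y + y', by simp only [map_add]; ring⟩
  neg_mem' := by
    rintro _ ⟨x, y, rfl⟩
    exact ⟨-x, -y, by simp only [map_neg]; ring⟩
  mul_mem' := by
    rintro _ _ ⟨x, y, rfl⟩ ⟨x', y', rfl⟩
    refine ⟨x * x' + c * (y * y'), x * y' + y * x' + y * y', ?_⟩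
    simp only [map_add, map_mul, map_intCast]
    linear_combination (zL L y * zL L y') * hω

theorem stmt_aux (D : ℤ) (hD : D % 8 = 5)
    (L : Type*) [Field L] [Algebra ℚ_[2] L] (hdim : Module.finrank ℚ_[2] L = 2)
    (α : L) (hα : α ^ 2 = (D : L)) (N : ℕ) (z w : L)
    (h : -w ^ 2 = 1 + 4 * (N : L) * z ^ 2 + 4 * z ^ 4) : False := by
  obtain ⟨k, hk⟩ : ∃ k : ℤ, D = 4 * (2 * k + 1) + 1 := ⟨D / 8, by omega⟩
  have : CharZero L := charZero_of_injective_algebraMap (algebraMap ℚ_[2] L).injective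
  have h20 : (2 : L) ≠ 0 := two_ne_zero
  set ω : L := (1 + α) / 2 with hωd
  have hαω : α = 2 * ω - 1 := by rw [hωd]; field_simp; ring
  have hω : ω ^ 2 = ω + ((2 * k + 1 : ℤ) : L) := by
    rw [hk, hαω] at hα
    push_cast at hα ⊢
    have : (4 : L) ≠ 0 := by norm_num
    apply mul_left_cancel₀ this
    linear_combination hα
  have hindep : ∀ a b : ℚ_[2], algebraMap ℚ_[2] L a + algebraMap ℚ_[2] L b * ω = 0 →
      a = 0 ∧ b = 0 := by
    intro a b hab
    have hb : b = 0 := by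
      by_contra hb
      have hb' : algebraMap ℚ_[2] L b ≠ 0 := by simpa using hb
      apply not_sq_two D hD (-2 * a / b - 1)
      apply (algebraMap ℚ_[2] L).injective
      rw [map_intCast, ← hα, hαω]
      have : ω = - algebraMap ℚ_[2] L a / algebraMap ℚ_[2] L b := by
        field_simp
        linear_combination hab
      rw [this]
      simp only [map_pow, map_sub, map_div₀, map_mul, map_neg, map_one, map_ofNat]
      ring
    subst hb
    simpa using hab
  have huniq : ∀ a b a' b' : ℤ_[2], zL L a + zL L b * ω =
      zL L a' + zL L b' * ω → a = a' ∧ b = b' := by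
    intro a b a' b' e
    obtain ⟨e1, e2⟩ := hindep (a - a') (b - b') (by
      simp only [map_sub]; simp only [zL_apply] at e; linear_combination e)
    exact ⟨Subtype.ext (sub_eq_zero.mp e1), Subtype.ext (sub_eq_zero.mp e2)⟩
  have hspan : ∀ l : L, ∃ a b : ℚ_[2], l = algebraMap ℚ_[2] L a + algebraMap ℚ_[2] L b * ω := by
    intro l
    have hli : LinearIndependent ℚ_[2] ![(1 : L), ω] := by
      rw [LinearIndependent.pair_iff]
      intro s t hst
      apply hindep
      simpa [Algebra.smul_def] using hst
    have htop := hli.span_eq_top_of_card_eq_finrank (by simp [hdim])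
    have hl : l ∈ Submodule.span ℚ_[2] (Set.range ![(1 : L), ω]) := by rw [htop]; trivial
    rw [Matrix.range_cons, Matrix.range_cons, Matrix.range_empty, Set.union_empty,
      Set.singleton_union, Submodule.mem_span_pair] at hl
    obtain ⟨a, b, e⟩ := hl
    exact ⟨a, b, by rw [← e]; simp [Algebra.smul_def]⟩
  have hp : Prime (2 : ℤ_[2]) := by exact_mod_cast PadicInt.prime_p (p := 2)
  refine key_no_sol h20 (ordO (2 * k + 1) ω hω) ?_ ?_ ?_ (N : L) z w ?_ h
  · rintro _ ⟨x, y, rfl⟩ ⟨_, ⟨u, v, rfl⟩, e⟩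
    obtain ⟨e1, e2⟩ := huniq (x ^ 2 + (2 * k + 1) * y ^ 2) (2 * x * y + y ^ 2) (2 * u) (2 * v) (by
      push_cast at hω
      simp only [map_add, map_mul, map_pow, map_intCast, map_one, map_ofNat]
      linear_combination e - (zL L y) ^ 2 * hω)
    have hy : (2 : ℤ_[2]) ∣ y :=
      hp.dvd_of_dvd_pow (n := 2) ⟨v - x * y, by linear_combination e2⟩
    obtain ⟨y', rfl⟩ := hy
    have hx : (2 : ℤ_[2]) ∣ x :=
      hp.dvd_of_dvd_pow (n := 2) ⟨u - (2 * k + 1) * 2 * y' ^ 2, by linear_combination e1⟩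
    obtain ⟨x', rfl⟩ := hx
    refine ⟨_, ⟨x', y', rfl⟩, ?_⟩
    simp only [map_mul, map_ofNat]
    ring
  · rintro ⟨_, ⟨u, v, rfl⟩, e⟩
    obtain ⟨e1, e2⟩ := huniq 1 0 (2 * u) (2 * v) (by
      simp only [map_mul, map_ofNat, map_one, map_zero]
      linear_combination e)
    exact hp.not_isUnit (IsUnit.of_mul_eq_one u e1.symm)
  · intro l
    obtain ⟨a, b, rfl⟩ := hspan l
    obtain ⟨n, hn⟩ := pad_scale a
    obtain ⟨m, hm⟩ := pad_scale b
    obtain ⟨x, hx⟩ := hn (max n m) (le_max_left _ _)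
    obtain ⟨y, hy⟩ := hm (max n m) (le_max_right _ _)
    refine ⟨max n m, x, y, ?_⟩
    rw [zL_apply, zL_apply, hx, hy]
    simp only [map_mul, map_ofNat, map_pow]
    ring
  · exact natCast_mem _ N

/-- Let `D ∈ {-11, -19, -43, -67, -163}` and let `p, q` be odd primes with `q = p + 2` and
`(D/p) = (D/q) = -1`. Let `L` be a field which is a `ℚ₂`-algebra of dimension 2 over `ℚ₂`,
and `α ∈ L` with `α² = D`. Then there are no `z, w ∈ L` with `-w² = 1 + 2(p+q)z² + 4z⁴`. -/
theorem stmt_6 (D : ℤ) (hD : D = -11 ∨ D = -19 ∨ D = -43 ∨ D = -67 ∨ D = -163)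
    (p q : ℕ) [Fact p.Prime] [Fact q.Prime] (hpo : Odd p) (hqo : Odd q)
    (hpq : q = p + 2) (hB : legendreSym p D = -1 ∧ legendreSym q D = -1)
    (L : Type*) [Field L] [Algebra ℚ_[2] L] (hdim : Module.finrank ℚ_[2] L = 2)
    (α : L) (hα : α ^ 2 = (D : L)) :
    ¬ ∃ z w : L, -w ^ 2 = 1 + 2 * ((p : L) + (q : L)) * z ^ 2 + 4 * z ^ 4 := by
  rintro ⟨z, w, h⟩
  refine stmt_aux D (by omega) L hdim α hα (p + 1) z w ?_
  rw [h, hpq]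
  push_cast
  ring
end

section
/- Let D be one of -11, -19, -43, -67, -163, and let p and q be odd prime numbers with q = p + 2 such that the Legendre symbols satisfy (D/p) = (D/q) = -1. Let L be a field equipped with a ℚ₂-algebra structure such that L has dimension 2 as a ℚ₂-vector space, and let α ∈ L satisfy α² = D. Then there exist z, w ∈ L with w² = 2 - 2(p+q)z² + 2z⁴ if and only if p ≡ 3 (mod 4). -/
theorem aux_sq (m : ℤ) : ∃ s : ℤ_[2], s ^ 2 = ((1 + 8 * m : ℤ) : ℤ_[2]) := by
  have h := hensels_lemma (p := 2) (R := ℤ_[2])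
    (F := (Polynomial.X ^ 2 + Polynomial.X - Polynomial.C ((2 * m : ℤ) : ℤ_[2]))) (a := (0 : ℤ_[2])) (by
      simp [Polynomial.derivative_X_pow]
      have h1 : ‖(m : ℤ_[2])‖ ≤ 1 := PadicInt.norm_le_one _
      have h2 : ‖(2 : ℤ_[2])‖ = 2⁻¹ := by simpa using PadicInt.norm_p (p := 2)
      rw [h2]; linarith)
  obtain ⟨t, ht, -⟩ := h
  refine ⟨1 + 2 * t, ?_⟩
  simp at ht
  push_cast
  linear_combination 4 * ht

theorem aux_notsq (k : ℤ) (x : ℚ_[2]) (hx : x ^ 2 = ((5 + 8 * k : ℤ) : ℚ_[2])) : False := by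
  have hn : ‖x‖ ≤ 1 := by
    have h1 : ‖x ^ 2‖ ≤ 1 := by rw [hx]; exact Padic.norm_int_le_one _
    rw [norm_pow] at h1
    nlinarith [norm_nonneg x]
  obtain ⟨y, rfl⟩ : ∃ y : ℤ_[2], (y : ℚ_[2]) = x := ⟨⟨x, hn⟩, rfl⟩
  have hy : y ^ 2 = ((5 + 8 * k : ℤ) : ℤ_[2]) := by
    apply Subtype.coe_injective
    push_cast at hx ⊢
    exact hx
  have h := congrArg (PadicInt.toZModPow (p := 2) 3) hy
  rw [map_pow, map_intCast] at h
  generalize PadicInt.toZModPow (p := 2) 3 y = u at h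
  have h8 : ((8 : ℤ) : ZMod (2 ^ 3)) = 0 := by decide
  have h' : u ^ 2 = 5 := by
    rw [h]; push_cast; push_cast at h8; rw [h8]; ring
  clear h
  revert u
  decide

/-- Abstract 2-descent over a domain in which 2 is a radical non-unit. -/
theorem aux_descent {R : Type*} [CommRing R] [IsDomain R] (h20 : (2 : R) ≠ 0)
    (h21 : ¬ (2 : R) ∣ 1) (hrad : ∀ x : R, (2 : R) ∣ x ^ 2 → (2 : R) ∣ x) (P : R)
    (hP : (4 : R) ∣ P - 1) (n : ℕ) : ∀ X Y : R,
      Y ^ 2 = 2 * (X ^ 2 - (2 ^ n) ^ 2) ^ 2 - 4 * P * X ^ 2 * (2 ^ n) ^ 2 → False := by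
  have h40 : (4 : R) ≠ 0 := by
    have : (4 : R) = 2 * 2 := by norm_num
    rw [this]; exact mul_ne_zero h20 h20
  -- common step
  have key : ∀ X Y Z : R, Y ^ 2 = 2 * (X ^ 2 - Z ^ 2) ^ 2 - 4 * P * X ^ 2 * Z ^ 2 →
      (2 : R) ∣ Y ∧ (2 : R) ∣ X - Z := by
    intro X Y Z h
    have hY : (2 : R) ∣ Y := hrad Y ⟨(X ^ 2 - Z ^ 2) ^ 2 - 2 * P * X ^ 2 * Z ^ 2, by rw [h]; ring⟩
    refine ⟨hY, ?_⟩
    obtain ⟨y, rfl⟩ := hY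
    have h1 : (2 : R) ∣ (X ^ 2 - Z ^ 2) ^ 2 :=
      ⟨y ^ 2 + P * X ^ 2 * Z ^ 2, by
        apply mul_left_cancel₀ h20; linear_combination -h⟩
    obtain ⟨c, hc⟩ := hrad _ h1
    exact hrad _ ⟨c + Z ^ 2 - X * Z, by linear_combination hc⟩
  induction n with
  | zero =>
    intro X Y h
    simp only [pow_zero] at h
    obtain ⟨⟨y, rfl⟩, ⟨t, ht⟩⟩ := key X Y 1 h
    obtain ⟨r, hr⟩ := hP
    have hX : X = 1 + 2 * t := by linear_combination ht
    subst hX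
    have hP' : P = 1 + 4 * r := by linear_combination hr
    subst hP'
    have h2 : y ^ 2 = 8 * (t * (t + 1)) ^ 2 - (1 + 4 * r) * (1 + 2 * t) ^ 2 := by
      apply mul_left_cancel₀ h40; linear_combination h
    obtain ⟨s, hs⟩ := hrad (y - 1) ⟨4 * (t * (t + 1)) ^ 2 - 2 * r * (1 + 2 * t) ^ 2
      - 2 * t - 2 * t ^ 2 - y, by linear_combination h2⟩
    have hy : y = 1 + 2 * s := by linear_combination hs
    subst hy
    apply h21
    refine ⟨2 * (t * (t + 1)) ^ 2 - r * (1 + 2 * t) ^ 2 - t - t ^ 2 - s - s ^ 2, ?_⟩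
    apply mul_left_cancel₀ h20
    linear_combination h2
  | succ n ih =>
    intro X Y h
    obtain ⟨⟨y, rfl⟩, ⟨t, ht⟩⟩ := key X Y _ h
    have hX : X = 2 * (t + 2 ^ n) := by rw [pow_succ] at ht; linear_combination ht
    subst hX
    generalize t + 2 ^ n = x at *
    have h3 : y ^ 2 = 4 * (2 * (x ^ 2 - (2 ^ n) ^ 2) ^ 2 - 4 * P * x ^ 2 * (2 ^ n) ^ 2) := by
      apply mul_left_cancel₀ h40; rw [pow_succ] at h; linear_combination h
    obtain ⟨y', rfl⟩ := hrad y ⟨2 * (2 * (x ^ 2 - (2 ^ n) ^ 2) ^ 2 - 4 * P * x ^ 2 * (2 ^ n) ^ 2),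
      by rw [h3]; ring⟩
    apply ih x y'
    apply mul_left_cancel₀ h40; linear_combination h3

theorem aux_two_dvd_sq {b : ℤ_[2]} (h : (2 : ℤ_[2]) ∣ b ^ 2) : (2 : ℤ_[2]) ∣ b := by
  have h2 : Prime (2 : ℤ_[2]) := by simpa using PadicInt.prime_p (p := 2)
  exact h2.dvd_of_dvd_pow h

theorem aux_denom (a : ℚ_[2]) : ∃ n : ℕ, ∀ m ≥ n, ∃ b : ℤ_[2], (b : ℚ_[2]) = 2 ^ m * a := by
  obtain ⟨n, hn⟩ := pow_unbounded_of_one_lt ‖a‖ (one_lt_two)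
  refine ⟨n, fun m hm => ⟨⟨2 ^ m * a, ?_⟩, rfl⟩⟩
  have h2 : ‖(2 : ℚ_[2])‖ = 2⁻¹ := by simpa using Padic.norm_p (p := 2)
  rw [norm_mul, norm_pow, h2, inv_pow, inv_mul_le_iff₀ (by positivity), mul_one]
  exact hn.le.trans (pow_le_pow_right₀ one_le_two hm)

theorem aux_forward (k : ℤ) (P : ℤ) (hP : (4 : ℤ) ∣ P - 1)
    (L : Type*) [Field L] [Algebra ℚ_[2] L] (hdim : Module.finrank ℚ_[2] L = 2)
    (α : L) (hα : α ^ 2 = ((5 + 8 * k : ℤ) : L)) (z w : L)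
    (h : w ^ 2 = 2 * (z ^ 2 - 1) ^ 2 - 4 * (P : L) * z ^ 2) : False := by
  haveI : CharZero L := charZero_of_injective_algebraMap (algebraMap ℚ_[2] L).injective
  have hα' : α ^ 2 = 5 + 8 * (k : L) := by rw [hα]; push_cast; ring
  -- independence
  have hind : ∀ a b : ℚ_[2], algebraMap ℚ_[2] L a + algebraMap ℚ_[2] L b * α = 0 → a = 0 ∧ b = 0 := by
    intro a b hab
    by_cases hb : b = 0
    · subst hb; simp at hab; exact ⟨hab, rfl⟩
    · exfalso
      apply aux_notsq k (-a / b)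
      apply (algebraMap ℚ_[2] L).injective
      have hb' : algebraMap ℚ_[2] L b ≠ 0 := by simpa using hb
      have : α = algebraMap ℚ_[2] L (-a / b) := by
        rw [map_div₀, map_neg]; field_simp; linear_combination hab
      rw [map_pow, ← this, hα, map_intCast]
  have hli : LinearIndependent ℚ_[2] ![(1 : L), α] := by
    rw [LinearIndependent.pair_iff]
    intro s t hst
    apply hind
    simpa [Algebra.smul_def] using hst
  have hspan := hli.span_eq_top_of_card_eq_finrank (by simp [hdim])
  have hrep : ∀ x : L, ∃ a b : ℚ_[2], x = algebraMap ℚ_[2] L a + algebraMap ℚ_[2] L b * α := by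
    intro x
    have hx : x ∈ Submodule.span ℚ_[2] (Set.range ![(1 : L), α]) := by rw [hspan]; trivial
    simp only [Matrix.range_cons, Matrix.range_empty, Set.union_empty, Set.singleton_union] at hx
    obtain ⟨a, b, hab⟩ := Submodule.mem_span_pair.1 hx
    exact ⟨a, b, by rw [← hab]; simp [Algebra.smul_def]⟩
  let g : ℤ_[2] →+* L := (algebraMap ℚ_[2] L).comp PadicInt.Coe.ringHom
  have hg : ∀ a : ℤ_[2], g a = algebraMap ℚ_[2] L (a : ℚ_[2]) := fun a => rfl
  let ω : L := (1 + α) / 2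
  have hω : ω ^ 2 = ω + (1 + 2 * (k : L)) := by
    simp only [ω]; field_simp; linear_combination hα'
  have hωind : ∀ a b : ℤ_[2], g a + g b * ω = 0 → a = 0 ∧ b = 0 := by
    intro a b hab
    have h1 := hind (2 * a + b) b (by
      rw [map_add, map_mul, ← hg, ← hg, map_ofNat]
      simp only [ω] at hab; field_simp at hab; linear_combination hab)
    have hb : (b : ℚ_[2]) = 0 := h1.2
    have ha := h1.1
    rw [hb] at ha
    simp at ha
    refine ⟨?_, ?_⟩
    · exact_mod_cast ha
    · exact Subtype.coe_injective hb
  let O : Subring L :=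
    { carrier := {x | ∃ a b : ℤ_[2], x = g a + g b * ω}
      zero_mem' := ⟨0, 0, by simp⟩
      one_mem' := ⟨1, 0, by simp⟩
      add_mem' := by
        rintro _ _ ⟨a, b, rfl⟩ ⟨c, d, rfl⟩
        exact ⟨a + c, b + d, by simp only [map_add]; ring⟩
      neg_mem' := by
        rintro _ ⟨a, b, rfl⟩
        exact ⟨-a, -b, by simp only [map_neg]; ring⟩
      mul_mem' := by
        rintro _ _ ⟨a, b, rfl⟩ ⟨c, d, rfl⟩
        refine ⟨a * c + b * d * (1 + 2 * k), a * d + b * c + b * d, ?_⟩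
        simp only [map_add, map_mul, map_one, map_ofNat, map_intCast]
        linear_combination g b * g d * hω }
  have hO : ∀ x : L, x ∈ O ↔ ∃ a b : ℤ_[2], x = g a + g b * ω := fun x => Iff.rfl
  -- divisibility by two
  have hdvd : ∀ a b : ℤ_[2], ∀ x : O, (x : L) = g a + g b * ω → (2 : O) ∣ x →
      (2 : ℤ_[2]) ∣ a ∧ (2 : ℤ_[2]) ∣ b := by
    rintro a b x hx ⟨⟨y, c, d, hy⟩, rfl⟩
    have h1 : (2 : L) * y = g a + g b * ω := hx
    have h2 := hωind (2 * c - a) (2 * d - b) (by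
      simp only [map_sub, map_mul, map_ofNat]
      linear_combination h1 - 2 * hy)
    exact ⟨⟨c, by linear_combination -h2.1⟩, ⟨d, by linear_combination -h2.2⟩⟩
  have h2ne : (2 : ℤ_[2]) ≠ 0 := two_ne_zero
  have hrad : ∀ x : O, (2 : O) ∣ x ^ 2 → (2 : O) ∣ x := by
    rintro ⟨x, a, b, rfl⟩ hx
    have h1 := hdvd (a ^ 2 + b ^ 2 * (1 + 2 * k)) (2 * a * b + b ^ 2) _ (by
      simp only [map_add, map_mul, map_one, map_ofNat, map_intCast, map_pow, Subring.coe_pow]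
      linear_combination g b ^ 2 * hω) hx
    have hb : (2 : ℤ_[2]) ∣ b := by
      apply aux_two_dvd_sq
      obtain ⟨c, hc⟩ := h1.2
      exact ⟨c - a * b, by linear_combination hc⟩
    have ha : (2 : ℤ_[2]) ∣ a := by
      apply aux_two_dvd_sq
      obtain ⟨c, hc⟩ := h1.1
      obtain ⟨d, rfl⟩ := hb
      exact ⟨c - 2 * d ^ 2 * (1 + 2 * k), by linear_combination hc⟩
    obtain ⟨c, rfl⟩ := ha
    obtain ⟨d, rfl⟩ := hb
    refine ⟨⟨g c + g d * ω, c, d, rfl⟩, ?_⟩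
    apply Subtype.ext
    change g (2 * c) + g (2 * d) * ω = 2 * (g c + g d * ω)
    simp only [map_mul, map_ofNat]; ring
  have h21 : ¬ (2 : O) ∣ 1 := by
    intro hx
    have h1 := (hdvd 1 0 1 (by simp) hx).1
    have h2 : Prime (2 : ℤ_[2]) := by simpa using PadicInt.prime_p (p := 2)
    exact h2.not_isUnit (isUnit_of_dvd_one h1)
  have h20 : (2 : O) ≠ 0 := by
    intro h0
    have : (2 : L) = 0 := congrArg Subtype.val h0
    exact two_ne_zero this
  have hden : ∀ x : L, ∃ n : ℕ, ∀ m ≥ n, 2 ^ m * x ∈ O := by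
    intro x
    obtain ⟨a, b, rfl⟩ := hrep x
    obtain ⟨n1, h1⟩ := aux_denom (a - b)
    obtain ⟨n2, h2⟩ := aux_denom (2 * b)
    refine ⟨max n1 n2, fun m hm => ?_⟩
    obtain ⟨c, hc⟩ := h1 m (le_trans (le_max_left _ _) hm)
    obtain ⟨d, hd⟩ := h2 m (le_trans (le_max_right _ _) hm)
    refine ⟨c, d, ?_⟩
    rw [hg, hg, hc, hd]
    simp only [map_mul, map_pow, map_ofNat, map_sub, ω]
    field_simp
    ring
  obtain ⟨n1, h1⟩ := hden z
  obtain ⟨n2, h2⟩ := hden w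
  let n := max n1 n2
  have hX := h1 n (le_max_left _ _)
  have hY := h2 (2 * n) (by have : n2 ≤ n := le_max_right _ _
                            omega)
  refine aux_descent h20 h21 hrad ((P : ℤ) : O) ?_ n ⟨_, hX⟩ ⟨_, hY⟩ ?_
  · obtain ⟨r, hr⟩ := hP
    refine ⟨(r : O), ?_⟩
    have := congrArg (Int.cast : ℤ → O) hr
    push_cast at this
    exact this
  · apply Subtype.ext
    change (2 ^ (2 * n) * w) ^ 2 = 2 * ((2 ^ n * z) ^ 2 - (2 ^ n) ^ 2) ^ 2
      - 4 * ((P : O) : L) * (2 ^ n * z) ^ 2 * (2 ^ n) ^ 2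
    have hPc : ((P : O) : L) = (P : L) := by simp
    rw [hPc, mul_comm 2 n, pow_mul]
    linear_combination ((2 : L) ^ n) ^ 4 * h



/-- Let `D ∈ {-11, -19, -43, -67, -163}` and let `p, q` be odd primes with `q = p + 2` and
`(D/p) = (D/q) = -1`. Let `L` be a field which is a `ℚ₂`-algebra of dimension 2 over `ℚ₂`,
and `α ∈ L` with `α² = D`. Then there exist `z, w ∈ L` with `w² = 2 - 2(p+q)z² + 2z⁴` if
and only if `p ≡ 3 (mod 4)`. -/
theorem stmt_7 (D : ℤ) (hD : D = -11 ∨ D = -19 ∨ D = -43 ∨ D = -67 ∨ D = -163)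
    (p q : ℕ) [Fact p.Prime] [Fact q.Prime] (hpo : Odd p) (hqo : Odd q)
    (hpq : q = p + 2) (hB : legendreSym p D = -1 ∧ legendreSym q D = -1)
    (L : Type*) [Field L] [Algebra ℚ_[2] L] (hdim : Module.finrank ℚ_[2] L = 2)
    (α : L) (hα : α ^ 2 = (D : L)) :
    (∃ z w : L, w ^ 2 = 2 - 2 * ((p : L) + (q : L)) * z ^ 2 + 2 * z ^ 4) ↔
      p % 4 = 3 := by
  subst hpq
  obtain ⟨k, hk⟩ : ∃ k : ℤ, D = 5 + 8 * k := ⟨(D - 5) / 8, by omega⟩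
  have hD0 : D ≠ 0 := by omega
  clear hD hB
  haveI : CharZero L := charZero_of_injective_algebraMap (algebraMap ℚ_[2] L).injective
  constructor
  · rintro ⟨z, w, h⟩
    by_contra hp
    obtain ⟨r, hr⟩ := hpo
    refine aux_forward k (p : ℤ) (by omega) L hdim α (by rw [hα, hk]) z w ?_
    rw [h]; push_cast; ring
  · intro hp
    let g : ℤ_[2] →+* L := (algebraMap ℚ_[2] L).comp PadicInt.Coe.ringHom
    have hs : ∃ s : L, s ^ 2 = -(p : L) := by
      by_cases h8 : p % 8 = 7
      · obtain ⟨s, hs⟩ := aux_sq ((-(p : ℤ) - 1) / 8)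
        refine ⟨g s, ?_⟩
        rw [← map_pow, hs, map_intCast,
          show 1 + 8 * ((-(p : ℤ) - 1) / 8) = -(p : ℤ) by omega]
        push_cast; ring
      · obtain ⟨j, hj⟩ : ∃ j : ℤ, (p : ℤ) = 3 + 8 * j := ⟨((p : ℤ) - 3) / 8, by omega⟩
        obtain ⟨s, hs⟩ := aux_sq (-2 - 3 * k - 5 * j - 8 * j * k)
        have hD' : (D : L) ≠ 0 := by exact_mod_cast hD0
        have hα0 : α ≠ 0 := by
          rintro rfl
          apply hD'; rw [← hα]; ring
        refine ⟨g s / α, ?_⟩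
        rw [div_pow, ← map_pow, hs, map_intCast, hα, div_eq_iff hD']
        rw [show 1 + 8 * (-2 - 3 * k - 5 * j - 8 * j * k) = -(p : ℤ) * D by rw [hj, hk]; ring]
        push_cast; ring
    obtain ⟨s, hs⟩ := hs
    refine ⟨1, 2 * s, ?_⟩
    push_cast
    linear_combination 4 * hs
end

section
/- Let p and q be prime numbers with q = p + 2 and p ≡ 1 (mod 4), and let a, b be integers with a² + b² = p. Let L be a field equipped with a ℚ₂-algebra structure such that L has dimension 2 as a ℚ₂-vector space, let α ∈ L satisfy α² = -1, and set μ = a + b·α ∈ L. Then there exist z, w ∈ L with μ·w² = μ² - (p+q)·μ·z² + pq·z⁴ if and only if b ≡ 0 (mod 4). -/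
set_option linter.unusedSimpArgs false
set_option maxRecDepth 100000 in
lemma sq8 : ∀ x y : ZMod 8, (x^2-y^2, 2*x*y) ∈ [((1:ZMod 8),(0:ZMod 8)),(5,4),(7,0),(3,4),(0,0),(4,0),(0,2),(0,6)] := by decide
set_option maxRecDepth 100000 in
lemma sq8' : ∀ x y : ZMod 8, (((y+2*x)^2-y^2, 2*(y+2*x)*y) : ZMod 8 × ZMod 8) ∈ [((0:ZMod 8),(0:ZMod 8)),(4,0),(0,2),(0,6)] := by decide
set_option maxRecDepth 100000 in
set_option maxHeartbeats 4000000 in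
/-- both integral -/
lemma fin1 : ∀ P ∈ [((1:ZMod 8),(0:ZMod 8)),(5,4),(7,0),(3,4),(0,0),(4,0),(0,2),(0,6)],
  ∀ Q ∈ [((1:ZMod 8),(0:ZMod 8)),(5,4),(7,0),(3,4),(0,0),(4,0),(0,2),(0,6)], ∀ a b : ZMod 8, 2*(a^2+b^2)=2 →
  (P.1-a)*(Q.1-a)-(P.2+b)*(Q.2-b) = -2 → (P.1-a)*(Q.2-b)+(P.2+b)*(Q.1-a)=0 → 2*b=0 := by decide
set_option maxRecDepth 100000 in
set_option maxHeartbeats 4000000 in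
/-- (1-μ̄ S)(Q-μ) = -2 S -/
lemma fin2 : ∀ S ∈ [((0:ZMod 8),(0:ZMod 8)),(4,0),(0,2),(0,6)],
  ∀ Q ∈ [((1:ZMod 8),(0:ZMod 8)),(5,4),(7,0),(3,4),(0,0),(4,0),(0,2),(0,6)], ∀ a b : ZMod 8, 2*(a^2+b^2)=2 →
  (1-(a*S.1+b*S.2))*(Q.1-a)+(a*S.2-b*S.1)*(Q.2-b) = -2*S.1 → (1-(a*S.1+b*S.2))*(Q.2-b)-(a*S.2-b*S.1)*(Q.1-a)=-2*S.2 → 2*b=0 := by decide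
set_option maxRecDepth 100000 in
lemma fin3 : ∀ S ∈ [((0:ZMod 8),(0:ZMod 8)),(4,0),(0,2),(0,6)],
  ∀ a b : ZMod 8, a*S.1+b*S.2 ≠ 1 := by decide

lemma padic_par (x : ℤ_[2]) : (∃ c, x = 2*c) ∨ (∃ c, x = 1+2*c) := by
  have h : ∀ x : ZMod (2^1), x = 0 ∨ x = 1 := by decide
  rcases h (PadicInt.toZModPow 1 x) with h | h
  · left
    have : x ∈ RingHom.ker (PadicInt.toZModPow (p:=2) 1) := h
    rw [PadicInt.ker_toZModPow, Ideal.mem_span_singleton] at this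
    obtain ⟨c, hc⟩ := this; exact ⟨c, by simpa using hc⟩
  · right
    have : x - 1 ∈ RingHom.ker (PadicInt.toZModPow (p:=2) 1) := by
      rw [RingHom.mem_ker, map_sub, h, map_one, sub_self]
    rw [PadicInt.ker_toZModPow, Ideal.mem_span_singleton] at this
    obtain ⟨c, hc⟩ := this; exact ⟨c, by simp at hc; linear_combination hc⟩

lemma odd_inv (c : ℤ_[2]) : ∃ v, v * (1+2*c) = 1 := by
  have : IsUnit (1+2*c) := by
    rcases IsLocalRing.isUnit_or_isUnit_of_add_one (a := 1+2*c) (b := -(2*c)) (by ring) with h | h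
    · exact h
    · exfalso
      have h2 : IsUnit (2:ℤ_[2]) := by
        rw [IsUnit.neg_iff] at h
        exact isUnit_of_mul_isUnit_left h
      exact PadicInt.prime_p (p:=2) |>.not_isUnit (by exact_mod_cast h2)
  obtain ⟨v, hv⟩ := this.exists_left_inv
  exact ⟨v, hv⟩

lemma inv_norm (y : ℤ_[2]) : ∃ v c, v*(1+y^2)=2 ∧ v * 1 = -(v*y) + 2*c := by
  rcases padic_par y with ⟨c, rfl⟩ | ⟨c, rfl⟩
  · obtain ⟨v, hv⟩ := odd_inv (2*c^2)
    exact ⟨2*v, v*(1+2*c), by linear_combination 2*hv, by ring⟩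
  · obtain ⟨v, hv⟩ := odd_inv (c+c^2)
    exact ⟨v, v*(1+c), by linear_combination 2*hv, by ring⟩

lemma hens (c e k : ℤ_[2]) (h : c + 4*e^2 = 1 + 8*k) : ∃ x : ℤ_[2], x ≠ 0 ∧ x^4 - c*x^2 - 4*e^2 = 0 := by
  obtain ⟨m, hm⟩ : ∃ m, m = 4*e^2 := ⟨_, rfl⟩
  rw [← hm] at h ⊢
  open Polynomial in
  let F : Polynomial ℤ_[2] := X^4 - C c * X^2 - C m
  have n2 : ‖(2:ℤ_[2])‖ = 1/2 := by simpa using PadicInt.norm_p (p:=2)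
  have h1 : F.derivative.aeval (1:ℤ_[2]) = 2 * (1 + 2*(2*e^2-4*k)) := by
    simp [F]; linear_combination -2*h + 2*hm
  have h0 : F.aeval (1:ℤ_[2]) = 2^3*(-k) := by
    simp [F]; linear_combination -h
  obtain ⟨v, hv⟩ := odd_inv (2*e^2-4*k)
  have nu : ‖1 + 2*(2*e^2-4*k)‖ = 1 := by
    rw [← PadicInt.isUnit_iff]; exact IsUnit.of_mul_eq_one v (by linear_combination hv)
  have nd : ‖F.derivative.aeval (1:ℤ_[2])‖ = 1/2 := by rw [h1, norm_mul, nu, n2]; norm_num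
  have := hensels_lemma (p:=2) (F:=F) (a:=1) (by
    rw [nd, h0, norm_mul, norm_pow, n2, norm_neg]
    have := PadicInt.norm_le_one k
    nlinarith)
  obtain ⟨z, hz, hz1, -⟩ := this
  refine ⟨z, ?_, ?_⟩
  · rintro rfl
    rw [nd] at hz1; simp at hz1; norm_num at hz1
  · simpa [F] using hz

section
variable {L : Type*} [Field L] [Algebra ℚ_[2] L]

lemma no_i (x : ℚ_[2]) : x^2 ≠ -1 := by
  intro h
  have hn : ‖x‖ ≤ 1 := by
    have : ‖x‖^2 = 1 := by rw [← norm_pow, h]; simp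
    nlinarith [norm_nonneg x]
  obtain ⟨y, hy⟩ : ∃ y : ℤ_[2], (y : ℚ_[2]) = x := ⟨⟨x, hn⟩, rfl⟩
  have h' : y^2 = -1 := by
    apply Subtype.ext; rw [← hy] at h; exact_mod_cast h
  have h8 := congrArg (PadicInt.toZModPow (p:=2) 3) h'
  rw [map_pow, map_neg, map_one] at h8
  revert h8
  generalize PadicInt.toZModPow (p:=2) 3 y = y
  revert y
  show ∀ y : ZMod 8, y^2 ≠ -1
  decide

lemma indep (α : L) (hα : α^2 = -1) (A B : ℚ_[2])
    (h : algebraMap ℚ_[2] L A + algebraMap ℚ_[2] L B * α = 0) : A = 0 ∧ B = 0 := by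
  have hB : B = 0 := by
    by_contra hB
    apply no_i (A/B)
    have : A^2 = -B^2 := by
      apply (algebraMap ℚ_[2] L).injective
      rw [map_neg, map_pow, map_pow]
      linear_combination (algebraMap ℚ_[2] L A - algebraMap ℚ_[2] L B * α) * h + (algebraMap ℚ_[2] L B)^2 * hα
    rw [div_pow, this]; field_simp
  subst hB
  simpa using h

lemma spans (hdim : Module.finrank ℚ_[2] L = 2) (α : L) (hα : α^2 = -1) (t : L) :
    ∃ X Y : ℚ_[2], t = algebraMap ℚ_[2] L X + algebraMap ℚ_[2] L Y * α := by
  have hl : LinearIndependent ℚ_[2] ![(1:L), α] := by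
    rw [LinearIndependent.pair_iff]
    intro s t h
    apply indep α hα
    simpa [Algebra.smul_def] using h
  have : Module.Finite ℚ_[2] L := Module.finite_of_finrank_pos (by omega)
  have := hl.span_eq_top_of_card_eq_finrank' (by simp [hdim])
  have ht : t ∈ Submodule.span ℚ_[2] (Set.range ![(1:L), α]) := by rw [this]; trivial
  rw [Matrix.range_cons, Matrix.range_cons, Matrix.range_empty, Set.union_empty, Set.singleton_union, Submodule.mem_span_pair] at ht
  obtain ⟨X, Y, h⟩ := ht
  exact ⟨X, Y, by rw [← h]; simp [Algebra.smul_def]⟩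

/-- The embedding of the 2-adic integers. -/
noncomputable def iot (L : Type*) [Field L] [Algebra ℚ_[2] L] : ℤ_[2] →+* L :=
  (algebraMap ℚ_[2] L).comp PadicInt.Coe.ringHom

lemma iot_apply (x : ℤ_[2]) : iot L x = algebraMap ℚ_[2] L (x : ℚ_[2]) := rfl

lemma indepZ (α : L) (hα : α^2 = -1) (A B : ℤ_[2])
    (h : iot L A + iot L B * α = 0) : A = 0 ∧ B = 0 := by
  have := indep α hα _ _ h
  exact ⟨Subtype.ext this.1, Subtype.ext this.2⟩

lemma dich_aux (α : L) (hα : α^2 = -1) (X Y : ℚ_[2]) (hX : 1 < ‖X‖) (hXY : ‖Y‖ ≤ ‖X‖) :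
    ∃ x y : ℤ_[2], (algebraMap ℚ_[2] L X + algebraMap ℚ_[2] L Y * α) *
      (iot L (y+2*x) + iot L y * α) = 1 := by
  have hX0 : X ≠ 0 := by rintro rfl; simp at hX; linarith
  have hy : ‖Y/X‖ ≤ 1 := by rw [norm_div]; exact div_le_one_of_le₀ hXY (norm_nonneg _)
  have hx : ‖X⁻¹‖ ≤ 1 := by rw [norm_inv]; exact inv_le_one_of_one_le₀ hX.le
  obtain ⟨y0, hy0⟩ : ∃ y0 : ℤ_[2], (y0 : ℚ_[2]) = Y / X := ⟨⟨_, hy⟩, rfl⟩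
  obtain ⟨x0, hx0⟩ : ∃ x0 : ℤ_[2], (x0 : ℚ_[2]) = X⁻¹ := ⟨⟨_, hx⟩, rfl⟩
  obtain ⟨x1, rfl⟩ : ∃ c, x0 = 2 * c := by
    rcases padic_par x0 with h | ⟨c, rfl⟩
    · exact h
    · exfalso
      obtain ⟨v, hv⟩ := odd_inv c
      have : ‖1+2*c‖ = 1 := by
        rw [← PadicInt.isUnit_iff]; exact IsUnit.of_mul_eq_one v (by linear_combination hv)
      have h2 : ‖X⁻¹‖ = 1 := by rw [← hx0]; exact this
      rw [norm_inv, inv_eq_one] at h2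
      linarith
  obtain ⟨v, c, hv, hc⟩ := inv_norm y0
  have e1 : iot L (2*x1) * algebraMap ℚ_[2] L X = 1 := by
    rw [iot_apply, hx0, ← map_mul, inv_mul_cancel₀ hX0, map_one]
  have e2 : iot L y0 * algebraMap ℚ_[2] L X = algebraMap ℚ_[2] L Y := by
    rw [iot_apply, hy0, ← map_mul, div_mul_cancel₀ _ hX0]
  refine ⟨x1*c, -(x1*v*y0), ?_⟩
  have e3 : -(x1*v*y0) + 2*(x1*c) = x1*v := by linear_combination -x1*hc
  have e4 := congrArg (iot L) hv
  rw [e3, ← e2]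
  simp only [map_mul, map_neg, map_add, map_pow, map_one, map_ofNat] at *
  linear_combination (iot L x1 * algebraMap ℚ_[2] L X) * e4 + e1 - (iot L x1 * algebraMap ℚ_[2] L X * iot L v * iot L y0^2)*hα

lemma dich (hdim : Module.finrank ℚ_[2] L = 2) (α : L) (hα : α^2 = -1) (t : L) :
    (∃ x y : ℤ_[2], t = iot L x + iot L y * α) ∨
    (∃ x y : ℤ_[2], t * (iot L (y+2*x) + iot L y * α) = 1) := by
  obtain ⟨X, Y, rfl⟩ := spans hdim α hα t
  by_cases h : ‖X‖ ≤ 1 ∧ ‖Y‖ ≤ 1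
  · exact Or.inl ⟨⟨X, h.1⟩, ⟨Y, h.2⟩, rfl⟩
  right
  rcases le_total ‖Y‖ ‖X‖ with h1 | h1
  · apply dich_aux α hα X Y _ h1
    by_contra h2
    exact h ⟨by linarith, by linarith⟩
  · obtain ⟨x, y, h3⟩ := dich_aux α hα Y (-X) (by
      by_contra h2
      exact h ⟨by linarith, by linarith⟩) (by simpa using h1)
    refine ⟨y + x, -(y+2*x), ?_⟩
    simp only [map_mul, map_neg, map_add, map_pow, map_one, map_ofNat] at *
    linear_combination h3 + (algebraMap ℚ_[2] L X * iot L y - algebraMap ℚ_[2] L Y * (iot L y+2*iot L x)) * hα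

/-- reduction mod 8 -/
noncomputable def red : ℤ_[2] →+* ZMod 8 := PadicInt.toZModPow (p:=2) 3

lemma to8' (α : L) (hα : α^2 = -1) (A B : ℤ_[2])
    (h : iot L A + iot L B * α = 0) : red A = 0 ∧ red B = 0 := by
  obtain ⟨rfl, rfl⟩ := indepZ α hα A B h
  exact ⟨map_zero _, map_zero _⟩

/-- The curve `(t²-μ̄)(r²-μ) = -2`. -/
lemma curve (hdim : Module.finrank ℚ_[2] L = 2) (α : L) (hα : α^2 = -1) (a b : ℤ)
    (hab : 2*((a:ZMod 8)^2+(b:ZMod 8)^2) = 2) (t r : L)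
    (h : (t^2 - ((a:L) - b*α)) * (r^2 - (a+b*α)) = -2) : 2*(b:ZMod 8) = 0 := by
  rcases dich hdim α hα t with ⟨x, y, rfl⟩ | ⟨x, y, ht⟩ <;>
  rcases dich hdim α hα r with ⟨u, v, rfl⟩ | ⟨u, v, hr⟩
  · have := to8' α hα ((x^2-y^2-a)*(u^2-v^2-a)-(2*x*y+b)*(2*u*v-b)+2)
      ((x^2-y^2-a)*(2*u*v-b)+(2*x*y+b)*(u^2-v^2-a)) (by
      simp only [map_mul, map_neg, map_add, map_sub, map_pow, map_one, map_ofNat, map_intCast]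
      generalize iot L x = x at *
      generalize iot L y = y at *
      generalize iot L u = u at *
      generalize iot L v = v at *
      grind)
    simp only [map_mul, map_neg, map_add, map_sub, map_pow, map_one, map_ofNat, map_intCast] at this
    exact fin1 _ (sq8 (red x) (red y)) _ (sq8 (red u) (red v)) a b hab
      (by linear_combination this.1) (by linear_combination this.2)
  · set ρ := iot L (v+2*u) + iot L v * α with hρ
    have h2 : (1 - (a+b*α) * ρ^2) * ((iot L x + iot L y * α)^2 - ((a:L) - b*α)) = -2*ρ^2 := by
      linear_combination ρ^2 * h - ((iot L x + iot L y * α)^2 - ((a:L) - b*α)) * (r*ρ+1)*hr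
    have := to8' α hα ((1-(a*((v+2*u)^2-v^2)-b*(2*(v+2*u)*v)))*(x^2-y^2-a)+(a*(2*(v+2*u)*v)+b*((v+2*u)^2-v^2))*(-(2*x*y+b)*(-1)) + 2*((v+2*u)^2-v^2))
      ((1-(a*((v+2*u)^2-v^2)-b*(2*(v+2*u)*v)))*(2*x*y+b)-(a*(2*(v+2*u)*v)+b*((v+2*u)^2-v^2))*(x^2-y^2-a) + 2*(2*(v+2*u)*v)) (by
      simp only [map_mul, map_neg, map_add, map_sub, map_pow, map_one, map_ofNat, map_intCast] at *
      generalize iot L x = x at *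
      generalize iot L y = y at *
      generalize iot L u = u at *
      generalize iot L v = v at *
      rw [hρ] at h2
      grind)
    simp only [map_mul, map_neg, map_add, map_sub, map_pow, map_one, map_ofNat, map_intCast] at this
    have := fin2 _ (sq8' (red u) (red v)) _ (sq8 (red x) (red y)) a (-b) (by linear_combination hab)
      (by linear_combination this.1) (by linear_combination this.2)
    linear_combination -this
  · set ρ := iot L (y+2*x) + iot L y * α with hρ
    have h2 : (1 - (a-b*α) * ρ^2) * ((iot L u + iot L v * α)^2 - ((a:L) + b*α)) = -2*ρ^2 := by
      linear_combination ρ^2 * h - ((iot L u + iot L v * α)^2 - ((a:L) + b*α)) * (t*ρ+1)*ht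
    have := to8' α hα ((1-(a*((y+2*x)^2-y^2)+b*(2*(y+2*x)*y)))*(u^2-v^2-a)+(a*(2*(y+2*x)*y)-b*((y+2*x)^2-y^2))*(2*u*v-b) + 2*((y+2*x)^2-y^2))
      ((1-(a*((y+2*x)^2-y^2)+b*(2*(y+2*x)*y)))*(2*u*v-b)-(a*(2*(y+2*x)*y)-b*((y+2*x)^2-y^2))*(u^2-v^2-a) + 2*(2*(y+2*x)*y)) (by
      simp only [map_mul, map_neg, map_add, map_sub, map_pow, map_one, map_ofNat, map_intCast] at *
      generalize iot L x = x at *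
      generalize iot L y = y at *
      generalize iot L u = u at *
      generalize iot L v = v at *
      rw [hρ] at h2
      grind)
    simp only [map_mul, map_neg, map_add, map_sub, map_pow, map_one, map_ofNat, map_intCast] at this
    exact fin2 _ (sq8' (red x) (red y)) _ (sq8 (red u) (red v)) a b hab
      (by linear_combination this.1) (by linear_combination this.2)
  · exfalso
    set ρ := iot L (y+2*x) + iot L y * α with hρ
    set σ := iot L (v+2*u) + iot L v * α with hσ
    have h2 : (1 - (a-b*α) * ρ^2) * (1 - ((a:L) + b*α)*σ^2) = -2*ρ^2*σ^2 := by
      have e1 : t^2*ρ^2 = 1 := by linear_combination (t*ρ+1)*ht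
      have e2 : r^2*σ^2 = 1 := by linear_combination (r*σ+1)*hr
      linear_combination ρ^2 * σ^2 * h - (r^2 - ((a:L) + b*α))*σ^2 * e1 - (1 - ((a:L) - b*α)*ρ^2) * e2
    -- 2 divides both squares
    have e1 : ρ^2 = 2 * (iot L (2*x*y+2*x^2) + iot L ((y+2*x)*y) * α) := by
      simp only [map_mul, map_neg, map_add, map_sub, map_pow, map_one, map_ofNat, map_intCast] at *
      rw [hρ]; linear_combination (iot L y)^2*hα
    have e2 : σ^2 = 2 * (iot L (2*u*v+2*u^2) + iot L ((v+2*u)*v) * α) := by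
      simp only [map_mul, map_neg, map_add, map_sub, map_pow, map_one, map_ofNat, map_intCast] at *
      rw [hσ]; linear_combination (iot L v)^2*hα
    rw [e1, e2] at h2
    clear e1 e2 ht hr h
    clear_value ρ σ
    clear hρ hσ ρ σ
    generalize 2*x*y+2*x^2 = A at h2
    generalize (y+2*x)*y = B at h2
    generalize 2*u*v+2*u^2 = C at h2
    generalize (v+2*u)*v = D at h2
    have := to8' α hα ((1-2*(a*A+b*B))*(1-2*(a*C-b*D))-(-2*(a*B-b*A))*(-2*(a*D+b*C)) + 8*(A*C-B*D))
      ((1-2*(a*A+b*B))*(-2*(a*D+b*C)) + (-2*(a*B-b*A))*(1-2*(a*C-b*D)) + 8*(A*D+B*C)) (by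
      simp only [map_mul, map_neg, map_add, map_sub, map_pow, map_one, map_ofNat, map_intCast] at *
      generalize iot L A = A at *
      generalize iot L B = B at *
      generalize iot L C = C at *
      generalize iot L D = D at *
      grind)
    have h3 := this.1
    simp only [map_mul, map_neg, map_add, map_sub, map_pow, map_one, map_ofNat, map_intCast] at h3
    have h8 : (8:ZMod 8) = 0 := rfl
    have h4 : ∀ P Q R S T : ZMod 8, (1-2*P)*(1-2*Q)-(-2*R)*(-2*S)+8*T = 0 → (4:ZMod 8) = 0 := by
      intro P Q R S T h
      linear_combination 4*h + (P+Q-2*P*Q+2*R*S-4*T)*h8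
    have h4 := h4 _ _ _ _ _ h3
    exact absurd h4 (by decide)

/-- `w² = μ`. -/
lemma sqcase (hdim : Module.finrank ℚ_[2] L = 2) (α : L) (hα : α^2 = -1) (a b : ℤ)
    (w : L) (h : w^2 = a+b*α) (hab : 2*((a:ZMod 8)^2+(b:ZMod 8)^2) = 2) : 2*(b:ZMod 8) = 0 := by
  rcases dich hdim α hα w with ⟨x, y, rfl⟩ | ⟨x, y, ht⟩
  · have := to8' α hα (x^2-y^2-a) (2*x*y-b) (by
      simp only [map_mul, map_neg, map_add, map_sub, map_pow, map_one, map_ofNat, map_intCast] at *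
      linear_combination h - (iot L y)^2*hα)
    simp only [map_mul, map_neg, map_add, map_sub, map_pow, map_one, map_ofNat, map_intCast] at this
    have key : ∀ P ∈ [((1:ZMod 8),(0:ZMod 8)),(5,4),(7,0),(3,4),(0,0),(4,0),(0,2),(0,6)],
      2*(P.1^2+P.2^2)=2 → 2*P.2=0 := by decide
    have ea : (a : ZMod 8) = red x^2 - red y^2 := by linear_combination -this.1
    have eb : (b : ZMod 8) = 2*red x*red y := by linear_combination -this.2
    have := key _ (sq8 (red x) (red y)) (by rw [ea, eb] at hab; exact hab)
    rw [eb]; exact this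
  · exfalso
    set ρ := iot L (y+2*x) + iot L y * α with hρ
    have h2 : (a+b*α)*ρ^2 = 1 := by
      rw [← h]; linear_combination (w*ρ+1)*ht
    have := to8' α hα (a*((y+2*x)^2-y^2)-b*(2*(y+2*x)*y)-1) (a*(2*(y+2*x)*y)+b*((y+2*x)^2-y^2)) (by
      simp only [map_mul, map_neg, map_add, map_sub, map_pow, map_one, map_ofNat, map_intCast] at *
      generalize iot L x = x at *
      generalize iot L y = y at *
      rw [hρ] at h2
      grind)
    simp only [map_mul, map_neg, map_add, map_sub, map_pow, map_one, map_ofNat, map_intCast] at this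
    exact fin3 _ (sq8' (red x) (red y)) a (-b) (by linear_combination this.1)

lemma sqrt_exists (α : L) (hα : α^2 = -1) (c e : ℤ) (h : (c + 4*e^2) % 8 = 1) :
    ∃ w : L, w^2 = c + 4*e*α := by
  obtain ⟨x, hx0, hx⟩ := hens c e (((c+4*e^2)/8 : ℤ) : ℤ_[2]) (by
    have : c + 4*e^2 = 1 + 8*((c+4*e^2)/8) := by omega
    exact_mod_cast this)
  have hx1 : iot L x ≠ 0 := by
    intro h0
    exact hx0 (indepZ α hα x 0 (by simp [h0])).1
  have hx2 := congrArg (iot L) hx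
  simp only [map_mul, map_neg, map_add, map_sub, map_pow, map_one, map_ofNat, map_intCast, map_zero] at hx2
  refine ⟨iot L x + 2*e/iot L x*α, ?_⟩
  field_simp
  linear_combination hx2 + 4*(e:L)^2*hα

lemma sqrt_exists' (α : L) (hα : α^2 = -1) (c e : ℤ) (h : (c + 4*e^2) % 8 = 1 ∨ (c+4*e^2)%8 = 7) :
    ∃ w : L, w^2 = c + 4*e*α := by
  rcases h with h | h
  · exact sqrt_exists α hα c e h
  · obtain ⟨w, hw⟩ := sqrt_exists α hα (-c) (-e) (by
      rw [neg_sq]; omega)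
    refine ⟨α*w, ?_⟩
    push_cast at hw
    linear_combination w^2*hα - hw
end

/-- Let `p` and `q` be primes with `q = p + 2` and `p ≡ 1 (mod 4)`, and `a, b ∈ ℤ` with
`a² + b² = p`. Let `L` be a field which is a `ℚ₂`-algebra of dimension 2 over `ℚ₂`,
`α ∈ L` with `α² = -1`, and `μ = a + b·α`. Then there exist `z, w ∈ L` with
`μ·w² = μ² - (p+q)·μ·z² + pq·z⁴` if and only if `b ≡ 0 (mod 4)`. -/
theorem stmt_15 (p q : ℕ) (hp : p.Prime) (hq : q.Prime) (hpq : q = p + 2)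
    (hp1 : p % 4 = 1) (a b : ℤ) (hab : a ^ 2 + b ^ 2 = (p : ℤ))
    (L : Type*) [Field L] [Algebra ℚ_[2] L] (hdim : Module.finrank ℚ_[2] L = 2)
    (α : L) (hα : α ^ 2 = -1) (μ : L) (hμ : μ = (a : L) + (b : L) * α) :
    (∃ z w : L,
        μ * w ^ 2 = μ ^ 2 - ((p : L) + (q : L)) * μ * z ^ 2 + (p : L) * (q : L) * z ^ 4) ↔
      b % 4 = 0 := by
  have hpL : (a:L)^2 + (b:L)^2 = p := by exact_mod_cast congrArg (Int.cast : ℤ → L) hab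
  have hqL : (q:L) = p + 2 := by rw [hpq]; push_cast; ring
  have h8 : 2*((a:ZMod 8)^2+(b:ZMod 8)^2) = 2 := by
    have : ((2*(a^2+b^2) : ℤ) : ZMod 8) = ((2:ℤ) : ZMod 8) := by
      rw [ZMod.intCast_eq_intCast_iff, hab]
      show _ % _ = _ % _
      push_cast
      omega
    exact_mod_cast this
  have hconj : (a + b*α) * ((a:L) - b*α) = p := by
    linear_combination hpL - (b:L)^2*hα
  constructor
  · rintro ⟨z, w, h⟩
    suffices hb : 2*(b:ZMod 8) = 0 by
      have : ((2*b : ℤ) : ZMod 8) = 0 := by exact_mod_cast hb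
      rw [ZMod.intCast_zmod_eq_zero_iff_dvd] at this
      push_cast at this
      omega
    have hμ0 : μ ≠ 0 := by
      rintro rfl
      rw [← hμ, zero_mul] at hconj
      have : CharZero L := charZero_of_injective_algebraMap (algebraMap ℚ_[2] L).injective
      exact hp.ne_zero (by exact_mod_cast hconj.symm)
    have hw : w^2 = (1 - ((a:L)-b*α)*z^2)*(a+b*α - q*z^2) := by
      apply mul_left_cancel₀ hμ0
      rw [h]
      rw [hμ]
      linear_combination ((a+b*α)*z^2 - q*z^4) * hconj
    by_cases hz : z = 0
    · subst hz
      exact sqcase hdim α hα a b w (by rw [hw]; ring) h8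
    by_cases hX : 1 - ((a:L)-b*α)*z^2 = 0
    · have := sqcase hdim α hα a (-b) z⁻¹ (by
        push_cast; field_simp; linear_combination hX) (by push_cast; linear_combination h8)
      push_cast at this
      linear_combination -this
    · refine curve hdim α hα a b h8 z⁻¹ (w/(1 - ((a:L)-b*α)*z^2)) ?_
      rw [div_pow, hw, hqL, ← hconj]
      have e1 : z⁻¹^2 - ((a:L)-b*α) = (1 - ((a:L)-b*α)*z^2)/z^2 := by
        field_simp
      rw [e1]
      field_simp
      ring
  · intro hb
    obtain ⟨e, rfl⟩ : ∃ e, b = 4*e := ⟨b/4, by omega⟩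
    push_cast at *
    have haodd : a % 2 = 1 := by
      rcases Int.emod_two_eq_zero_or_one a with h | h
      · exfalso
        obtain ⟨k, rfl⟩ : ∃ k, a = 2*k := ⟨a/2, by omega⟩
        have : (p:ℤ) = 4*(k^2+4*e^2) := by rw [← hab]; ring
        omega
      · exact h
    by_cases hc : (a + 4*e^2) % 8 = 1 ∨ (a+4*e^2)%8 = 7
    · obtain ⟨w, hw⟩ := sqrt_exists' (L := L) α hα a e hc
      refine ⟨0, w, ?_⟩
      rw [hw, hμ]; ring
    · have hq8 : (q:ℤ) % 8 = 3 := by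
        obtain ⟨k, rfl⟩ : ∃ k, a = 2*k+1 := ⟨a/2, by omega⟩
        obtain ⟨j, hj⟩ := Int.even_mul_succ_self k
        have : (p:ℤ) = 1 + 8*(j+2*e^2) := by rw [← hab]; linear_combination 4*hj
        rw [hpq]; push_cast; omega
      obtain ⟨m, hm⟩ : ∃ m : ℤ, (q:ℤ) = 8*m+3 := ⟨q/8, by omega⟩
      have hp' : (p:ℤ) = 8*m+1 := by rw [hpq] at hm; push_cast at hm; linarith
      obtain ⟨w, hw⟩ := sqrt_exists' (L := L) α hα (64^2*a - 64*(p+q) + q*a) ((64^2-q)*e) (by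
        have : (64^2*a - 64*(p+q) + q*a) + 4*((64^2-q)*e)^2 = 3*(a+4*e^2) + 8*(512*a - 8*(16*m+4) + m*a + 3*e^2 + e^2*(32*(m-512)^2+24*(m-512))) := by
          rw [hm, hp']; ring
        rw [this]
        have hu : (a + 4*e^2) % 2 = 1 := by omega
        revert hc hu
        generalize a + 4*e^2 = u
        generalize 512*a - 8*(16*m+4) + m*a + 3*e^2 + e^2*(32*(m-512)^2+24*(m-512)) = K
        intro hc hu
        clear this
        have : u % 8 = 3 ∨ u % 8 = 5 := by omega
        rcases this with h | h
        · left; omega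
        · right; omega)
      refine ⟨1/8, w/64, ?_⟩
      have : CharZero L := charZero_of_injective_algebraMap (algebraMap ℚ_[2] L).injective
      push_cast at hw
      rw [div_pow, hw, hμ]
      field_simp
      rw [← hconj]
      ring
end

section
/- Let p and q be prime numbers with q = p + 2 and p ≡ 3 (mod 4). Let L be a field equipped with a ℚ₂-algebra structure such that L has dimension 2 as a ℚ₂-vector space, and let α ∈ L satisfy α² = -1. Then there exist z, w ∈ L with -α·w² - 1 - (p+q)·α·z² + pq·z⁴ = 0 if and only if p ≡ 7 (mod 8). -/
theorem aux_cast2 : (((2 : ℤ_[2])) : ℚ_[2]) = 2 :=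
  map_ofNat (PadicInt.Coe.ringHom (p := 2)) 2

theorem aux_cast16 : (((16 : ℤ_[2])) : ℚ_[2]) = 16 :=
  map_ofNat (PadicInt.Coe.ringHom (p := 2)) 16

theorem aux_cast32 : (((32 : ℤ_[2])) : ℚ_[2]) = 32 :=
  map_ofNat (PadicInt.Coe.ringHom (p := 2)) 32

theorem aux_sq_add_one (u v : ℤ_[2]) : 1 + u ^ 2 ≠ 4 * v := by
  intro h
  have h2 := congrArg (PadicInt.toZModPow (p := 2) 2) h
  simp only [map_add, map_mul, map_pow, map_one, map_ofNat] at h2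
  generalize PadicInt.toZModPow (p := 2) 2 u = a at h2
  generalize PadicInt.toZModPow (p := 2) 2 v = b at h2
  revert a b
  decide

theorem aux_int_wlog (x y : ℚ_[2]) (h : ‖x ^ 2 + y ^ 2‖ ≤ 1) (hyx : ‖y‖ ≤ ‖x‖) : ‖x‖ ≤ 1 := by
  by_contra! hx
  have hx0 : x ≠ 0 := by
    rintro rfl
    simp at hx
    linarith
  have hxpos : 0 < ‖x‖ := norm_pos_iff.mpr hx0
  have hv : ‖x⁻¹‖ < 1 := by
    rw [norm_inv]; exact inv_lt_one_of_one_lt₀ hx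
  have hu : ‖y / x‖ ≤ 1 := by
    rw [norm_div]; exact (div_le_one hxpos).mpr hyx
  have hd : ((2 : ℕ) : ℤ_[2]) ∣ (⟨x⁻¹, hv.le⟩ : ℤ_[2]) :=
    (PadicInt.norm_lt_one_iff_dvd _).mp hv
  obtain ⟨v, hvv⟩ := hd
  have hvv' : x⁻¹ = 2 * (v : ℚ_[2]) := by
    have := congrArg (fun t : ℤ_[2] => (t : ℚ_[2])) hvv
    simpa [aux_cast2, aux_cast16, aux_cast32] using this
  apply aux_sq_add_one ⟨y / x, hu⟩ (⟨x ^ 2 + y ^ 2, h⟩ * v ^ 2)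
  apply Subtype.ext
  push_cast
  change 1 + (y / x) ^ 2 = 4 * ((x ^ 2 + y ^ 2) * (v : ℚ_[2]) ^ 2)
  have : (4 : ℚ_[2]) * ((x ^ 2 + y ^ 2) * (v : ℚ_[2]) ^ 2) = (x ^ 2 + y ^ 2) * (x⁻¹) ^ 2 := by
    rw [hvv']; ring
  rw [this]
  field_simp

theorem aux_int (x y : ℚ_[2]) (h : ‖x ^ 2 + y ^ 2‖ ≤ 1) :
    ∃ a b : ℤ_[2], x = a ∧ y = b := by
  have : ‖x‖ ≤ 1 ∧ ‖y‖ ≤ 1 := by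
    rcases le_total ‖y‖ ‖x‖ with hh | hh
    · have := aux_int_wlog x y h hh
      exact ⟨this, hh.trans this⟩
    · have := aux_int_wlog y x (by rwa [add_comm]) hh
      exact ⟨hh.trans this, this⟩
  exact ⟨⟨x, this.1⟩, ⟨y, this.2⟩, rfl, rfl⟩

theorem aux_neg_one (c : ℚ_[2]) : c ^ 2 ≠ -1 := by
  intro h
  obtain ⟨a, b, ha, -⟩ := aux_int c 1 (by rw [h]; simp)
  apply aux_sq_add_one a 0
  apply Subtype.ext
  push_cast
  rw [← ha, h]; ring

theorem aux_z : ∀ A B m : ZMod (2 ^ 4), m = 4 ∨ m = 12 →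
    ∀ X Y : ZMod (2 ^ 4),
    X = (1 - m * (2 * A * B)) ^ 2 - m ^ 2 * (A ^ 2 - B ^ 2) ^ 2 + (A ^ 2 - B ^ 2) ^ 2
        - (2 * A * B) ^ 2 →
    Y = -(2 * m * (A ^ 2 - B ^ 2) * (1 - m * (2 * A * B)) + 2 * (A ^ 2 - B ^ 2) * (2 * A * B)) →
    8 * X = 8 ∨ (X = 2 ∧ Y = 8) ∨ (X = 10 ∧ Y = 0) := by
  have : ∀ A B m : ZMod (2 ^ 4), m = 4 ∨ m = 12 →
    8 * ((1 - m * (2 * A * B)) ^ 2 - m ^ 2 * (A ^ 2 - B ^ 2) ^ 2 + (A ^ 2 - B ^ 2) ^ 2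
        - (2 * A * B) ^ 2) = 8 ∨
    ((1 - m * (2 * A * B)) ^ 2 - m ^ 2 * (A ^ 2 - B ^ 2) ^ 2 + (A ^ 2 - B ^ 2) ^ 2
        - (2 * A * B) ^ 2 = 2 ∧
     -(2 * m * (A ^ 2 - B ^ 2) * (1 - m * (2 * A * B)) + 2 * (A ^ 2 - B ^ 2) * (2 * A * B)) = 8) ∨
    ((1 - m * (2 * A * B)) ^ 2 - m ^ 2 * (A ^ 2 - B ^ 2) ^ 2 + (A ^ 2 - B ^ 2) ^ 2
        - (2 * A * B) ^ 2 = 10 ∧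
     -(2 * m * (A ^ 2 - B ^ 2) * (1 - m * (2 * A * B)) + 2 * (A ^ 2 - B ^ 2) * (2 * A * B)) = 0)
      := by
    have h4 : ∀ A B : ZMod (2 ^ 4), 
      8 * ((1 - 4 * (2 * A * B)) ^ 2 - 4 ^ 2 * (A ^ 2 - B ^ 2) ^ 2 + (A ^ 2 - B ^ 2) ^ 2
        - (2 * A * B) ^ 2) = 8 ∨
    ((1 - 4 * (2 * A * B)) ^ 2 - 4 ^ 2 * (A ^ 2 - B ^ 2) ^ 2 + (A ^ 2 - B ^ 2) ^ 2
        - (2 * A * B) ^ 2 = 2 ∧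
     -(2 * 4 * (A ^ 2 - B ^ 2) * (1 - 4 * (2 * A * B)) + 2 * (A ^ 2 - B ^ 2) * (2 * A * B)) = 8) ∨
    ((1 - 4 * (2 * A * B)) ^ 2 - 4 ^ 2 * (A ^ 2 - B ^ 2) ^ 2 + (A ^ 2 - B ^ 2) ^ 2
        - (2 * A * B) ^ 2 = 10 ∧
     -(2 * 4 * (A ^ 2 - B ^ 2) * (1 - 4 * (2 * A * B)) + 2 * (A ^ 2 - B ^ 2) * (2 * A * B)) = 0)
      := by
      set_option maxRecDepth 100000 in decide +kernel
    have h12 : ∀ A B : ZMod (2 ^ 4), 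
      8 * ((1 - 12 * (2 * A * B)) ^ 2 - 12 ^ 2 * (A ^ 2 - B ^ 2) ^ 2 + (A ^ 2 - B ^ 2) ^ 2
        - (2 * A * B) ^ 2) = 8 ∨
    ((1 - 12 * (2 * A * B)) ^ 2 - 12 ^ 2 * (A ^ 2 - B ^ 2) ^ 2 + (A ^ 2 - B ^ 2) ^ 2
        - (2 * A * B) ^ 2 = 2 ∧
     -(2 * 12 * (A ^ 2 - B ^ 2) * (1 - 12 * (2 * A * B)) + 2 * (A ^ 2 - B ^ 2) * (2 * A * B)) = 8) ∨
    ((1 - 12 * (2 * A * B)) ^ 2 - 12 ^ 2 * (A ^ 2 - B ^ 2) ^ 2 + (A ^ 2 - B ^ 2) ^ 2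
        - (2 * A * B) ^ 2 = 10 ∧
     -(2 * 12 * (A ^ 2 - B ^ 2) * (1 - 12 * (2 * A * B)) + 2 * (A ^ 2 - B ^ 2) * (2 * A * B)) = 0)
      := by
      set_option maxRecDepth 100000 in decide +kernel
    rintro A B m (rfl | rfl)
    · exact h4 A B
    · exact h12 A B
  rintro A B m hm X Y rfl rfl
  exact this A B m hm

theorem aux_w : ∀ C D : ZMod (2 ^ 4), 
    ¬ (8 * (2 * C * D) = 8 ∨ (2 * C * D = 2 ∧ C ^ 2 - D ^ 2 = 8) ∨
      (2 * C * D = 10 ∧ C ^ 2 - D ^ 2 = 0)) := by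
  set_option maxRecDepth 100000 in decide +kernel

/-- No integral points `z` when `m = p + 1` is `4` mod `8`. -/
theorem aux_case1 (m : ℕ) (hm : m % 8 = 4) (a b c d : ℤ_[2])
    (h1 : 2 * c * d = (1 - m * (2 * a * b)) ^ 2 - m ^ 2 * (a ^ 2 - b ^ 2) ^ 2 + (a ^ 2 - b ^ 2) ^ 2
        - (2 * a * b) ^ 2)
    (h2 : c ^ 2 - d ^ 2 =
      -(2 * m * (a ^ 2 - b ^ 2) * (1 - m * (2 * a * b)) + 2 * (a ^ 2 - b ^ 2) * (2 * a * b))) :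
    False := by
  have e1 := congrArg (PadicInt.toZModPow (p := 2) 4) h1
  have e2 := congrArg (PadicInt.toZModPow (p := 2) 4) h2
  simp only [map_add, map_sub, map_neg, map_mul, map_pow, map_one, map_ofNat, map_natCast] at e1 e2
  have hm' : (m : ZMod (2 ^ 4)) = 4 ∨ (m : ZMod (2 ^ 4)) = 12 := by
    have : m % 2 ^ 4 = 4 ∨ m % 2 ^ 4 = 12 := by omega
    rw [← ZMod.natCast_mod m (2 ^ 4)]
    rcases this with h | h <;> rw [h] <;> simp
  exact aux_w _ _ (aux_z _ _ _ hm' _ _ e1 e2)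

theorem aux_case2 (m : ℕ) (hm : m % 8 = 4) (a b c d : ℤ_[2]) (n : ℤ_[2])
    (hn : a ^ 2 + b ^ 2 = 2 * n)
    (h1 : 2 * c * d = (a ^ 2 - b ^ 2) ^ 2 - (2 * a * b + m) ^ 2 + 1) :
    False := by
  have e1 := congrArg (PadicInt.toZModPow (p := 2) 1) h1
  have e2 := congrArg (PadicInt.toZModPow (p := 2) 1) hn
  simp only [map_add, map_sub, map_neg, map_mul, map_pow, map_one, map_ofNat, map_natCast] at e1 e2
  have hm' : (m : ZMod (2 ^ 1)) = 0 := by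
    rw [← ZMod.natCast_mod m (2 ^ 1)]
    have : m % 2 ^ 1 = 0 := by omega
    rw [this]; simp
  rw [hm'] at e1
  generalize PadicInt.toZModPow (p := 2) 1 a = A at *
  generalize PadicInt.toZModPow (p := 2) 1 b = B at *
  generalize PadicInt.toZModPow (p := 2) 1 c = C at *
  generalize PadicInt.toZModPow (p := 2) 1 d = D at *
  generalize PadicInt.toZModPow (p := 2) 1 n = N at *
  clear hn h1 hm hm'
  revert A B C D N
  decide

/-- If `(c + d i)^2 = e + f i` with `e, f` integral then `c, d` are integral. -/
theorem aux_root_int (c d : ℚ_[2]) (e f : ℤ_[2]) (h1 : 2 * c * d = f) (h2 : c ^ 2 - d ^ 2 = e) :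
    ∃ c' d' : ℤ_[2], c = c' ∧ d = d' := by
  apply aux_int
  have : (c ^ 2 + d ^ 2) ^ 2 = ((e ^ 2 + f ^ 2 : ℤ_[2]) : ℚ_[2]) := by
    push_cast
    rw [← h1, ← h2]; ring
  have h3 : ‖c ^ 2 + d ^ 2‖ ^ 2 ≤ 1 := by
    rw [← norm_pow, this]
    exact PadicInt.norm_le_one _
  have := norm_nonneg (c ^ 2 + d ^ 2)
  nlinarith

theorem aux_coord {L : Type*} [Field L] [Algebra ℚ_[2] L] (α : L) (hα : α ^ 2 = -1)
    (x y : ℚ_[2]) (h : algebraMap ℚ_[2] L x + algebraMap ℚ_[2] L y * α = 0) : x = 0 ∧ y = 0 := by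
  have hy : y = 0 := by
    by_contra hy
    apply aux_neg_one (x / y)
    apply (algebraMap ℚ_[2] L).injective
    have hy' : algebraMap ℚ_[2] L y ≠ 0 := by simpa using hy
    have hx : algebraMap ℚ_[2] L x = - (algebraMap ℚ_[2] L y * α) := by
      linear_combination h
    rw [map_pow, map_div₀, hx, map_neg, map_one, ← hα]
    field_simp
  subst hy
  simpa using h

theorem aux_basis {L : Type*} [Field L] [Algebra ℚ_[2] L] (hdim : Module.finrank ℚ_[2] L = 2)
    (α : L) (hα : α ^ 2 = -1) (z : L) :
    ∃ x y : ℚ_[2], z = algebraMap ℚ_[2] L x + algebraMap ℚ_[2] L y * α := by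
  have hli : LinearIndependent ℚ_[2] ![(1 : L), α] := by
    rw [LinearIndependent.pair_iff]
    intro s t h
    apply aux_coord α hα
    simpa [Algebra.smul_def] using h
  have : FiniteDimensional ℚ_[2] L := FiniteDimensional.of_finrank_pos (by omega)
  have hs := hli.span_eq_top_of_card_eq_finrank' (by simp [hdim])
  have hz : z ∈ Submodule.span ℚ_[2] (Set.range ![(1 : L), α]) := by rw [hs]; trivial
  rw [Matrix.range_cons, Matrix.range_cons, Matrix.range_empty, Set.union_empty,
    Set.singleton_union, Submodule.mem_span_pair] at hz
  obtain ⟨x, y, h⟩ := hz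
  exact ⟨x, y, by rw [← h]; simp [Algebra.smul_def]⟩

theorem aux_hensel (k : ℕ) : ∃ x : ℤ_[2], x ^ 4 - (1 - 32 * k ^ 2) * x ^ 2 - 16 * k ^ 2 = 0 := by
  let F : Polynomial ℤ_[2] := Polynomial.X ^ 4 - Polynomial.C (1 - 32 * (k : ℤ_[2]) ^ 2) * Polynomial.X ^ 2
    - Polynomial.C (16 * (k : ℤ_[2]) ^ 2)
  have hF : ∀ x, F.aeval x = x ^ 4 - (1 - 32 * (k : ℤ_[2]) ^ 2) * x ^ 2 - 16 * k ^ 2 := by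
    intro x; simp [F]
  have hF' : F.derivative.aeval (1 : ℤ_[2]) = 2 * (1 + 2 * (16 * (k : ℤ_[2]) ^ 2)) := by
    simp [F, Polynomial.derivative_pow]
    ring
  have n2 : ‖(2 : ℤ_[2])‖ = 1 / 2 := by
    have := PadicInt.norm_p (p := 2)
    simpa using this
  have hu : ‖(1 + 2 * (16 * (k : ℤ_[2]) ^ 2))‖ = 1 := by
    apply le_antisymm (PadicInt.norm_le_one _)
    by_contra! hlt
    obtain ⟨t, ht⟩ := (PadicInt.norm_lt_one_iff_dvd _).mp hlt
    have e := congrArg (PadicInt.toZModPow (p := 2) 1) ht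
    simp only [map_add, map_mul, map_one, map_ofNat, map_natCast, map_pow] at e
    generalize (PadicInt.toZModPow (p := 2) 1 t) = T at e
    generalize (k : ZMod (2 ^ 1)) = K at e
    revert K T
    decide
  have hn : ‖F.aeval (1 : ℤ_[2])‖ < ‖F.derivative.aeval (1 : ℤ_[2])‖ ^ 2 := by
    rw [hF', hF, norm_mul, hu, n2]
    have : (1 : ℤ_[2]) ^ 4 - (1 - 32 * (k : ℤ_[2]) ^ 2) * 1 ^ 2 - 16 * k ^ 2 = 2 ^ 4 * k ^ 2 := by
      ring
    rw [this, norm_mul, norm_pow, n2]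
    have := PadicInt.norm_le_one ((k : ℤ_[2]) ^ 2)
    linarith
  obtain ⟨x, hx, -⟩ := hensels_lemma hn
  exact ⟨x, by rw [← hF]; exact hx⟩

theorem stmt_17 (p q : ℕ) (hp : p.Prime) (hq : q.Prime) (hpq : q = p + 2)
    (hp3 : p % 4 = 3)
    (L : Type*) [Field L] [Algebra ℚ_[2] L] (hdim : Module.finrank ℚ_[2] L = 2)
    (α : L) (hα : α ^ 2 = -1) :
    (∃ z w : L,
        -α * w ^ 2 - 1 - ((p : L) + (q : L)) * α * z ^ 2 + (p : L) * (q : L) * z ^ 4 = 0) ↔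
      p % 8 = 7 := by
  obtain ⟨m, hm⟩ : ∃ m : ℕ, m = p + 1 := ⟨_, rfl⟩
  have hpm : (p : L) = m - 1 := by rw [hm]; push_cast; ring
  have hqm : (q : L) = m + 1 := by rw [hpq, hm]; push_cast; ring
  rw [hpm, hqm]
  constructor
  · rintro ⟨z, w, h⟩
    by_contra hp7
    have hm8 : m % 8 = 4 := by omega
    have h' : w ^ 2 = α * ((1 + m * α * z ^ 2) ^ 2 + z ^ 4) := by
      linear_combination α * h + (w ^ 2 - α * m ^ 2 * z ^ 4) * hα
    obtain ⟨a, b, rfl⟩ := aux_basis hdim α hα z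
    by_cases hint : ‖a ^ 2 + b ^ 2‖ ≤ 1
    · obtain ⟨a', b', rfl, rfl⟩ := aux_int a b hint
      obtain ⟨c, d, rfl⟩ := aux_basis hdim α hα w
      obtain ⟨E2, E1⟩ := aux_coord α hα
        (c ^ 2 - d ^ 2 + (2 * m * (a' ^ 2 - b' ^ 2) * (1 - m * (2 * a' * b'))
          + 2 * (a' ^ 2 - b' ^ 2) * (2 * a' * b')))
        (2 * c * d - ((1 - m * (2 * a' * b')) ^ 2 - m ^ 2 * (a' ^ 2 - b' ^ 2) ^ 2
          + (a' ^ 2 - b' ^ 2) ^ 2 - (2 * a' * b') ^ 2)) (by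
          simp only [map_add, map_sub, map_mul, map_pow, map_one, map_ofNat, map_natCast]
          generalize algebraMap ℚ_[2] L a' = A at *
          generalize algebraMap ℚ_[2] L b' = B at *
          generalize algebraMap ℚ_[2] L c = C at *
          generalize algebraMap ℚ_[2] L d = D at *
          clear * - h' hα
          grind)
      obtain ⟨c', d', rfl, rfl⟩ := aux_root_int c d
        (-(2 * m * (a' ^ 2 - b' ^ 2) * (1 - m * (2 * a' * b'))
          + 2 * (a' ^ 2 - b' ^ 2) * (2 * a' * b')))
        ((1 - m * (2 * a' * b')) ^ 2 - m ^ 2 * (a' ^ 2 - b' ^ 2) ^ 2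
          + (a' ^ 2 - b' ^ 2) ^ 2 - (2 * a' * b') ^ 2)
        (by push_cast [aux_cast2, aux_cast16, aux_cast32]; linear_combination E1) (by push_cast [aux_cast2, aux_cast16, aux_cast32]; linear_combination E2)
      refine aux_case1 m hm8 a' b' c' d' ?_ ?_
      · apply Subtype.ext; push_cast [aux_cast2, aux_cast16, aux_cast32]; linear_combination E1
      · apply Subtype.ext; push_cast [aux_cast2, aux_cast16, aux_cast32]; linear_combination E2
    · push Not at hint
      have hN0 : a ^ 2 + b ^ 2 ≠ 0 := by
        intro h0; rw [h0] at hint; simp at hint; linarith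
      have hz0 : algebraMap ℚ_[2] L a + algebraMap ℚ_[2] L b * α ≠ 0 := by
        intro h0
        obtain ⟨rfl, rfl⟩ := aux_coord α hα a b h0
        simp at hN0
      obtain ⟨s, t, hst⟩ := aux_basis hdim α hα (algebraMap ℚ_[2] L a + algebraMap ℚ_[2] L b * α)⁻¹
      have hone : (algebraMap ℚ_[2] L a + algebraMap ℚ_[2] L b * α) *
        (algebraMap ℚ_[2] L s + algebraMap ℚ_[2] L t * α) = 1 := by
        rw [← hst]; exact mul_inv_cancel₀ hz0
      obtain ⟨F1, F2⟩ := aux_coord α hα (a * s - b * t - 1) (a * t + b * s) (by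
          simp only [map_add, map_sub, map_mul, map_one]
          linear_combination hone - (algebraMap ℚ_[2] L b) * (algebraMap ℚ_[2] L t) * hα)
      have hNN : (a ^ 2 + b ^ 2) * (s ^ 2 + t ^ 2) = 1 := by
        linear_combination (a * s - b * t + 1) * F1 + (a * t + b * s) * F2
      have hlt : ‖s ^ 2 + t ^ 2‖ < 1 := by
        have := congrArg norm hNN
        rw [norm_mul, norm_one] at this
        have := norm_nonneg (s ^ 2 + t ^ 2)
        nlinarith
      obtain ⟨s', t', rfl, rfl⟩ := aux_int s t hlt.le
      obtain ⟨n, hn⟩ := (PadicInt.norm_lt_one_iff_dvd (s' ^ 2 + t' ^ 2)).mp hlt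
      obtain ⟨c, d, hcd⟩ := aux_basis hdim α hα (w * 
        (algebraMap ℚ_[2] L s' + algebraMap ℚ_[2] L t' * α) ^ 2)
      generalize hz : algebraMap ℚ_[2] L a + algebraMap ℚ_[2] L b * α = z at *
      have h'' : (algebraMap ℚ_[2] L c + algebraMap ℚ_[2] L d * α) ^ 2 = 
          α * (((algebraMap ℚ_[2] L s' + algebraMap ℚ_[2] L t' * α) ^ 2 + m * α) ^ 2 + 1) := by
        rw [← hcd, ← hst, mul_pow, h']
        field_simp
      obtain ⟨E2, E1⟩ := aux_coord α hα
        (c ^ 2 - d ^ 2 + 2 * (s' ^ 2 - t' ^ 2) * (2 * s' * t' + m))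
        (2 * c * d - ((s' ^ 2 - t' ^ 2) ^ 2 - (2 * s' * t' + m) ^ 2 + 1)) (by
          simp only [map_add, map_sub, map_mul, map_pow, map_one, map_ofNat, map_natCast]
          generalize algebraMap ℚ_[2] L s' = A at *
          generalize algebraMap ℚ_[2] L t' = B at *
          generalize algebraMap ℚ_[2] L c = C at *
          generalize algebraMap ℚ_[2] L d = D at *
          clear * - h'' hα
          grind)
      obtain ⟨c', d', rfl, rfl⟩ := aux_root_int c d
        (- (2 * (s' ^ 2 - t' ^ 2) * (2 * s' * t' + m)))
        ((s' ^ 2 - t' ^ 2) ^ 2 - (2 * s' * t' + m) ^ 2 + 1)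
        (by push_cast [aux_cast2, aux_cast16, aux_cast32]; linear_combination E1) (by push_cast [aux_cast2, aux_cast16, aux_cast32]; linear_combination E2)
      refine aux_case2 m hm8 s' t' c' d' n (by simpa using hn) ?_
      apply Subtype.ext; push_cast [aux_cast2, aux_cast16, aux_cast32]; linear_combination E1
  · intro hp7
    obtain ⟨k, hk⟩ : ∃ k : ℕ, m = 8 * k := ⟨m / 8, by omega⟩
    have hk0 : k ≠ 0 := by rintro rfl; omega
    obtain ⟨x, hx⟩ := aux_hensel k
    have hx0 : x ≠ 0 := by
      rintro rfl
      simp [hk0] at hx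
    have hX0 : algebraMap ℚ_[2] L x ≠ 0 := by simpa using hx0
    have hX : (algebraMap ℚ_[2] L x) ^ 4 - (1 - 32 * (k : L) ^ 2) * (algebraMap ℚ_[2] L x) ^ 2
        - 16 * (k : L) ^ 2 = 0 := by
      have := congrArg (fun t : ℤ_[2] => algebraMap ℚ_[2] L (t : ℚ_[2])) hx
      have e16 : algebraMap ℚ_[2] L 16 = 16 := map_ofNat _ 16
      have e32 : algebraMap ℚ_[2] L 32 = 32 := map_ofNat _ 32
      simpa [aux_cast2, aux_cast16, aux_cast32, e16, e32] using this
    generalize algebraMap ℚ_[2] L x = X at *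
    have hkm : (m : L) = 8 * k := by rw [hk]; push_cast; ring
    rw [hkm]
    refine ⟨1, (1 + α) * (X + 4 * k / X * α), ?_⟩
    have hY : X * (4 * k / X) = 4 * k := by field_simp
    have hXY : X ^ 2 - (4 * k / X) ^ 2 = 1 - 32 * (k : L) ^ 2 := by
      field_simp
      linear_combination hX
    generalize 4 * k / X = Y at *
    clear * - hα hY hXY
    grind
end

section
/- Let p and q be odd prime numbers with q = p + 2 and p ≡ 2 (mod 3), and let s, t be integers with s² - s·t + t² = q. Let L be a field equipped with a ℚ₂-algebra structure such that L has dimension 2 as a ℚ₂-vector space, let α ∈ L satisfy α² = -3, and set τ = (-1+α)/2 and μ = s + t·τ ∈ L. Then there exist z, w ∈ L with μ·w² = μ² + (p+q)·μ·z² + pq·z⁴ if and only if p ≡ 17 or 23 (mod 24). -/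
namespace Stmt19

abbrev RR := QuadraticAlgebra ℤ_[2] (-1) (-1)

noncomputable abbrev pr : ℤ_[2] →+* ZMod 16 := PadicInt.toZModPow (p := 2) 4

theorem unit_or_even (x : ℤ_[2]) : IsUnit x ∨ (2 : ℤ_[2]) ∣ x := by
  by_cases h : IsUnit x
  · exact Or.inl h
  · right
    rw [PadicInt.not_isUnit_iff, PadicInt.norm_lt_one_iff_dvd] at h
    exact_mod_cast h

theorem dvd_of_pr (x : ℤ_[2]) (h : 8 * pr x = 0) : (2 : ℤ_[2]) ∣ x := by
  rcases unit_or_even x with hu | hd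
  · exfalso
    have h1 : IsUnit (pr x) := hu.map pr
    have h2 : (8 : ZMod 16) = 0 := by
      have := h1.mul_left_eq_zero.mp h
      exact this
    revert h2; decide
  · exact hd

theorem unit_of_pr (x : ℤ_[2]) (h : 8 * pr x ≠ 0) : IsUnit x := by
  rcases unit_or_even x with hu | ⟨y, rfl⟩
  · exact hu
  · exfalso; apply h
    rw [map_mul, ← mul_assoc]
    have : (8 : ZMod 16) * pr 2 = 0 := by
      rw [map_ofNat]; decide
    rw [this, zero_mul]

theorem pr_of_unit (x : ℤ_[2]) (h : IsUnit x) : 8 * pr x ≠ 0 := by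
  intro h8
  have h1 : IsUnit (pr x) := h.map pr
  have h2 : (8 : ZMod 16) = 0 := h1.mul_left_eq_zero.mp h8
  revert h2; decide

theorem dvd8_of_pr (x : ℤ_[2]) (h : 2 * pr x = 0) : (8 : ℤ_[2]) ∣ x := by
  have h1 : pr (2 * x) = 0 := by rw [map_mul, map_ofNat, h]
  have h2 : 2 * x ∈ RingHom.ker (PadicInt.toZModPow (p := 2) 4) := h1
  rw [PadicInt.ker_toZModPow, Ideal.mem_span_singleton] at h2
  obtain ⟨y, hy⟩ := h2
  refine ⟨y, ?_⟩
  have h3 : (2 : ℤ_[2]) ≠ 0 := two_ne_zero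
  apply mul_left_cancel₀ h3
  rw [hy]; push_cast; ring

/-- norm form -/
def nf {S : Type*} [CommRing S] (a b : S) : S := a ^ 2 - a * b + b ^ 2

theorem norm_eq (x : RR) : x.norm = nf x.re x.im := by
  rw [QuadraticAlgebra.norm_def]; unfold nf; ring

theorem pr_nf (a b : ℤ_[2]) : pr (nf a b) = nf (pr a) (pr b) := by
  unfold nf; simp only [map_add, map_sub, map_mul, map_pow]

theorem dec0 : ∀ c d : ZMod 16, nf c d ^ 2 = 0 ∨ nf c d ^ 2 = 1 ∨ nf c d ^ 2 = 9 := by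
  unfold nf; decide

theorem dec0' : ∀ c d : ZMod 16, 8 * nf c d = 0 → 8 * c = 0 ∧ 8 * d = 0 := by
  unfold nf; decide +kernel

theorem dec1 : ∀ p : ZMod 16, (p = 3 ∨ p = 5 ∨ p = 11 ∨ p = 13) → ∀ k, (k = 0 ∨ k = 1 ∨ k = 9) →
   ∀ l, (l = 0 ∨ l = 1 ∨ l = 9) → ∀ a b : ZMod 16, (p + 2) * k = nf (a - 1) b →
    (p + 2) * l = nf a b * nf (p * a + 2) (p * b) → 8 * a = 0 ∧ 8 * b = 0 := by
  unfold nf; rintro p (rfl|rfl|rfl|rfl) k (rfl|rfl|rfl) l (rfl|rfl|rfl) <;> decide +kernel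

theorem dec2 : ∀ p : ZMod 16, (p = 3 ∨ p = 5 ∨ p = 11 ∨ p = 13) → ∀ k, (k = 0 ∨ k = 1 ∨ k = 9) →
   ∀ l, (l = 0 ∨ l = 1 ∨ l = 9) → ∀ a b : ZMod 16, (p + 2) * k = nf (2 * a - 1) (2 * b) →
    (p + 2) * l ≠ nf a b * nf (p * a + 1) (p * b) := by
  unfold nf; rintro p (rfl|rfl|rfl|rfl) k (rfl|rfl|rfl) l (rfl|rfl|rfl) <;> decide +kernel

theorem dec3 : ∀ s t : ZMod 16, 2 * nf s t = 2 → ∃ c d : ZMod 16,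
    (2 * s = 2 * (c ^ 2 - d ^ 2) ∧ 2 * t = 2 * (2 * c * d - d ^ 2)) ∨
    (2 * s = - (2 * (c ^ 2 - d ^ 2)) ∧ 2 * t = - (2 * (2 * c * d - d ^ 2))) := by
  unfold nf; decide +kernel

/-- Contraction: `y + 2y² = x` is solvable. -/
theorem solve_contr (x : RR) : ∃ y : RR, y + 2 * y ^ 2 = x := by
  let f : ℤ_[2] × ℤ_[2] → ℤ_[2] × ℤ_[2] := fun y =>
    (x.re - 2 * (y.1 ^ 2 - y.2 ^ 2), x.im - 2 * (2 * y.1 * y.2 - y.2 ^ 2))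
  have h2 : ‖(2 : ℤ_[2])‖ = 1 / 2 := by
    have := PadicInt.norm_p (p := 2); simpa using this
  have key : ∀ u v a b : ℤ_[2], ‖2 * (u * a + v * b)‖ ≤ 1 / 2 * max ‖a‖ ‖b‖ := by
    intro u v a b
    rw [norm_mul, h2]
    gcongr
    refine (PadicInt.nonarchimedean _ _).trans ?_
    rw [norm_mul, norm_mul]
    apply max_le_max
    · exact mul_le_of_le_one_left (norm_nonneg _) (PadicInt.norm_le_one _)
    · exact mul_le_of_le_one_left (norm_nonneg _) (PadicInt.norm_le_one _)
  have hf : ContractingWith (1 / 2) f := by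
    refine ⟨by norm_num, LipschitzWith.of_dist_le_mul ?_⟩
    rintro ⟨a, b⟩ ⟨c, d⟩
    rw [Prod.dist_eq, Prod.dist_eq]
    simp only [dist_eq_norm, f]
    have e1 : x.re - 2 * (a ^ 2 - b ^ 2) - (x.re - 2 * (c ^ 2 - d ^ 2)) =
      2 * (-(a + c) * (a - c) + (b + d) * (b - d)) := by ring
    have e2 : x.im - 2 * (2 * a * b - b ^ 2) - (x.im - 2 * (2 * c * d - d ^ 2)) =
      2 * ((-2 * b) * (a - c) + (b + d - 2 * c) * (b - d)) := by ring
    have hh : ((1 / 2 : NNReal) : ℝ) = 1 / 2 := by norm_num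
    rw [e1, e2, hh]
    exact max_le (key _ _ _ _) (key _ _ _ _)
  obtain ⟨y, hy, -⟩ := hf.exists_fixedPoint (0, 0) (edist_ne_top _ _)
  have hy' : f y = y := hy
  obtain ⟨a, b⟩ := y
  simp only [f, Prod.mk.injEq] at hy'
  refine ⟨⟨a, b⟩, ?_⟩
  ext
  · simp [pow_two, QuadraticAlgebra.re_ofNat, QuadraticAlgebra.im_ofNat]
    linear_combination -hy'.1
  · simp [pow_two, QuadraticAlgebra.re_ofNat, QuadraticAlgebra.im_ofNat]
    linear_combination -hy'.2

theorem sq_one_add (x : RR) : ∃ y : RR, y ^ 2 = 1 + 8 * x := by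
  obtain ⟨y, hy⟩ := solve_contr x
  exact ⟨1 + 4 * y, by rw [← hy]; ring⟩

theorem sq_of_near (u c x : RR) (hc : IsUnit c) (h : u = c ^ 2 + 8 * x) : ∃ y : RR, y ^ 2 = u := by
  obtain ⟨d, hd⟩ := hc.exists_right_inv
  obtain ⟨y, hy⟩ := sq_one_add (x * d ^ 2)
  refine ⟨c * y, ?_⟩
  rw [mul_pow, hy, h]
  linear_combination 8 * x * (c * d + 1) * hd

theorem pm_sq (u : RR) (h : 2 * pr u.norm = 2) : ∃ v : RR, u = v ^ 2 ∨ u = - v ^ 2 := by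
  rw [norm_eq, pr_nf] at h
  obtain ⟨c, d, hcd⟩ := dec3 _ _ h
  obtain ⟨c, rfl⟩ : ∃ c', pr c' = c := ZMod.ringHom_surjective pr c
  obtain ⟨d, rfl⟩ : ∃ c', pr c' = d := ZMod.ringHom_surjective pr d
  have main : ∀ a b : ℤ_[2], 2 * pr (nf a b) = 2 → 2 * pr a = 2 * (pr c ^ 2 - pr d ^ 2) →
      2 * pr b = 2 * (2 * pr c * pr d - pr d ^ 2) → ∃ v : RR, v ^ 2 = ⟨a, b⟩ := by
    intro a b hab h1 h2
    obtain ⟨x, hx⟩ := dvd8_of_pr (a - (c ^ 2 - d ^ 2)) (by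
      simp only [map_sub, map_pow]; linear_combination h1)
    obtain ⟨y, hy⟩ := dvd8_of_pr (b - (2 * c * d - d ^ 2)) (by
      simp only [map_sub, map_pow, map_mul, map_ofNat]; linear_combination h2)
    have e : (⟨a, b⟩ : RR) = (⟨c, d⟩ : RR) ^ 2 + 8 * ⟨x, y⟩ := by
      ext
      · simp [pow_two, QuadraticAlgebra.re_ofNat, QuadraticAlgebra.im_ofNat]; linear_combination hx
      · simp [pow_two, QuadraticAlgebra.re_ofNat, QuadraticAlgebra.im_ofNat]; linear_combination hy
    refine sq_of_near _ ⟨c, d⟩ ⟨x, y⟩ ?_ e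
    rw [QuadraticAlgebra.isUnit_iff_norm_isUnit, norm_eq]
    rcases unit_or_even (nf c d) with hu | ⟨k, hk⟩
    · exact hu
    · exfalso
      have ha : a = (c ^ 2 - d ^ 2) + 8 * x := by linear_combination hx
      have hb : b = (2 * c * d - d ^ 2) + 8 * y := by linear_combination hy
      have h2 : (2 : ℤ_[2]) ∣ nf a b := by
        have : nf a b = nf c d ^ 2 + 2 * (4 * (x * (2 * (c ^ 2 - d ^ 2) + 8 * x)
          - (c ^ 2 - d ^ 2) * y - x * (2 * c * d - d ^ 2) - 8 * x * y
          + y * (2 * (2 * c * d - d ^ 2) + 8 * y))) := by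
          rw [ha, hb]; unfold nf; ring
        rw [this]
        exact dvd_add (Dvd.dvd.pow ⟨k, hk⟩ two_ne_zero) (dvd_mul_right _ _)
      obtain ⟨j, hj⟩ := h2
      rw [hj, map_mul, map_ofNat] at hab
      have : ∀ r : ZMod 16, 2 * (2 * r) ≠ 2 := by decide
      exact this _ hab
  rcases hcd with ⟨h1, h2⟩ | ⟨h1, h2⟩
  · obtain ⟨v, hv⟩ := main u.re u.im (by rw [pr_nf]; exact h) h1 h2
    exact ⟨v, Or.inl (by rw [hv])⟩
  · obtain ⟨v, hv⟩ := main (-u.re) (-u.im)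
      (by rw [pr_nf, map_neg, map_neg]; refine Eq.trans ?_ h; unfold nf; ring) (by rw [map_neg]; linear_combination -h1)
      (by rw [map_neg]; linear_combination -h2)
    refine ⟨v, Or.inr ?_⟩
    rw [hv]; ext <;> simp

theorem unit_pr (x : RR) : IsUnit x ↔ 8 * pr x.norm ≠ 0 := by
  rw [QuadraticAlgebra.isUnit_iff_norm_isUnit]
  exact ⟨pr_of_unit _, unit_of_pr _⟩

theorem even_of (x : RR) (h : 8 * pr x.re = 0 ∧ 8 * pr x.im = 0) : ∃ y : RR, x = 2 * y := by
  obtain ⟨a, ha⟩ := dvd_of_pr _ h.1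
  obtain ⟨b, hb⟩ := dvd_of_pr _ h.2
  refine ⟨⟨a, b⟩, ?_⟩
  ext <;> simp [QuadraticAlgebra.re_ofNat, QuadraticAlgebra.im_ofNat, ha, hb]

theorem p_cases (p : ℕ) (hp : p % 8 = 3 ∨ p % 8 = 5) :
    (p : ZMod 16) = 3 ∨ (p : ZMod 16) = 5 ∨ (p : ZMod 16) = 11 ∨ (p : ZMod 16) = 13 := by
  rw [← ZMod.natCast_mod p 16]
  have : p % 16 = 3 ∨ p % 16 = 5 ∨ p % 16 = 11 ∨ p % 16 = 13 := by omega
  rcases this with h | h | h | h <;> rw [h] <;> simp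

theorem two_cancel {x y : RR} (h : 2 * x = 2 * y) : x = y := by
  have h1 := congrArg QuadraticAlgebra.re h
  have h2 := congrArg QuadraticAlgebra.im h
  simp [QuadraticAlgebra.re_ofNat, QuadraticAlgebra.im_ofNat] at h1 h2
  ext
  · exact h1
  · exact h2

theorem no_int (p : ℕ) (hp : p % 8 = 3 ∨ p % 8 = 5) (m z w X : RR) (hm : m.norm = p + 2)
    (hX : X = 1 + m * z ^ 2) (h : m * w ^ 2 = X * (p * X + 2)) : False := by
  have hpc := p_cases p hp
  have n1 : (X - 1).norm = (p + 2) * z.norm ^ 2 := by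
    rw [hX, add_sub_cancel_left, map_mul, map_pow, hm]
  have n2 := congrArg QuadraticAlgebra.norm h
  rw [map_mul, map_mul, map_pow, hm] at n2
  have q1 := congrArg pr n1
  have q2 := congrArg pr n2
  simp only [norm_eq, map_mul, map_pow, map_add, pr_nf, map_natCast, map_ofNat,
    QuadraticAlgebra.re_sub, QuadraticAlgebra.im_sub, QuadraticAlgebra.re_one,
    QuadraticAlgebra.im_one, QuadraticAlgebra.re_add, QuadraticAlgebra.im_add,
    QuadraticAlgebra.re_mul, QuadraticAlgebra.im_mul, QuadraticAlgebra.re_natCast,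
    QuadraticAlgebra.im_natCast, QuadraticAlgebra.re_ofNat, QuadraticAlgebra.im_ofNat,
    map_sub, map_one, map_zero, mul_zero, zero_mul, add_zero, sub_zero, map_neg] at q1 q2
  obtain ⟨Y, rfl⟩ := even_of X (dec1 _ hpc _ (dec0 _ _) _ (dec0 _ _) _ _ q1.symm q2)
  have hw : ∃ w', w = 2 * w' := by
    by_contra hcon
    have hu : IsUnit w := by
      rw [unit_pr]
      intro h0
      rw [norm_eq, pr_nf] at h0
      exact hcon (even_of w (dec0' _ _ h0))
    have hmu : IsUnit m := by
      rw [unit_pr, hm, map_add, map_natCast, map_ofNat]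
      rcases hpc with h | h | h | h <;> rw [h] <;> decide
    have : IsUnit (2 * (Y * (p * (2 * Y) + 2))) := by
      have := hmu.mul (hu.pow 2)
      rw [h] at this
      convert this using 1; ring
    have h2 := isUnit_of_mul_isUnit_left this
    rw [unit_pr, norm_eq] at h2
    apply h2
    simp only [QuadraticAlgebra.re_ofNat, QuadraticAlgebra.im_ofNat]
    rw [pr_nf, map_ofNat, map_zero]; decide
  obtain ⟨w', rfl⟩ := hw
  have h' : m * w' ^ 2 = Y * (p * Y + 1) := by
    apply two_cancel; apply two_cancel; linear_combination h
  have n3 := congrArg QuadraticAlgebra.norm h'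
  rw [map_mul, map_mul, map_pow, hm] at n3
  have q3 := congrArg pr n3
  have q1 := congrArg pr n1
  simp only [norm_eq, map_mul, map_pow, map_add, pr_nf, map_natCast, map_ofNat,
    QuadraticAlgebra.re_sub, QuadraticAlgebra.im_sub, QuadraticAlgebra.re_one,
    QuadraticAlgebra.im_one, QuadraticAlgebra.re_add, QuadraticAlgebra.im_add,
    QuadraticAlgebra.re_mul, QuadraticAlgebra.im_mul, QuadraticAlgebra.re_natCast,
    QuadraticAlgebra.im_natCast, QuadraticAlgebra.re_ofNat, QuadraticAlgebra.im_ofNat,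
    map_sub, map_one, map_zero, mul_zero, zero_mul, add_zero, sub_zero, map_neg] at q1 q3
  exact dec2 _ hpc _ (dec0 _ _) _ (dec0 _ _) _ _ q1.symm q3

theorem dec4 : ∀ p : ZMod 16, (p = 3 ∨ p = 5 ∨ p = 11 ∨ p = 13) →
    ∀ l, (l = 0 ∨ l = 1 ∨ l = 9) → ∀ n : ZMod 16, 8 * n = 8 →
    2 * ((p + 2) * l) ≠ 2 * (p ^ 2 * n ^ 2) := by
  decide +kernel

theorem no_inf (p : ℕ) (hp : p % 8 = 3 ∨ p % 8 = 5) (m y w X : RR) (hm : m.norm = p + 2)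
    (hX : X = 4 * y + m) (h : m * w ^ 2 = X * (p * X + 8 * y)) : False := by
  have hpc := p_cases p hp
  have n2 := congrArg QuadraticAlgebra.norm h
  have n1 := congrArg QuadraticAlgebra.norm hX
  rw [map_mul, map_mul, map_pow, hm] at n2
  have q2 := congrArg pr n2
  have q1 := congrArg pr n1
  have qm := congrArg pr hm
  simp only [norm_eq, map_mul, map_pow, map_add, pr_nf, map_natCast, map_ofNat,
    QuadraticAlgebra.re_add, QuadraticAlgebra.im_add,
    QuadraticAlgebra.re_mul, QuadraticAlgebra.im_mul, QuadraticAlgebra.re_natCast,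
    QuadraticAlgebra.im_natCast, QuadraticAlgebra.re_ofNat, QuadraticAlgebra.im_ofNat,
    map_zero, mul_zero, zero_mul, add_zero, map_neg] at q1 q2 qm
  have h16 : (16 : ZMod 16) = 0 := by decide
  refine dec4 _ hpc _ (dec0 (pr w.re) (pr w.im)) (nf (pr X.re) (pr X.im)) ?_ ?_
  · have e : 8 * nf (pr m.re) (pr m.im) = 8 := by
      rw [qm]
      rcases hpc with h | h | h | h <;> rw [h] <;> decide
    rw [q1]
    refine Eq.trans ?_ e
    unfold nf
    linear_combination (8 * pr y.re ^ 2 + 4 * pr y.re * pr m.re - 8 * pr y.re * pr y.im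
      - 2 * pr y.re * pr m.im - 2 * pr m.re * pr y.im + 8 * pr y.im ^ 2 + 4 * pr y.im * pr m.im) * h16
  · rw [q2]
    generalize pr X.re = a
    generalize pr X.im = b
    generalize pr y.re = c
    generalize pr y.im = d
    generalize (p : ZMod 16) = P
    unfold nf
    linear_combination (a ^ 2 - a * b + b ^ 2) * (2 * P * a * c + 8 * c ^ 2 - P * a * d - P * c * b
      - 8 * c * d + 2 * P * b * d + 8 * d ^ 2) * h16

/-- the inclusion of `ℤ_[2]` in `ℚ_[2]` -/
noncomputable abbrev incl : ℤ_[2] →+* ℚ_[2] := PadicInt.Coe.ringHom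

theorem incl_inj : Function.Injective incl := fun _ _ h => PadicInt.ext h

theorem incl_lift (c : ℚ_[2]) (h : ‖c‖ ≤ 1) : ∃ d : ℤ_[2], incl d = c ∧ ‖d‖ = ‖c‖ :=
  ⟨⟨c, h⟩, rfl, rfl⟩

theorem exists_phi {L : Type*} [Field L] [Algebra ℚ_[2] L] (τ : L) (hτ : τ ^ 2 = -1 - τ) :
    ∃ φ : RR →+* L, ∀ r : RR, φ r = algebraMap ℚ_[2] L (incl r.re) + algebraMap ℚ_[2] L (incl r.im) * τ := by
  refine ⟨{ toFun := fun r => algebraMap ℚ_[2] L (incl r.re) + algebraMap ℚ_[2] L (incl r.im) * τ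
            map_one' := ?_
            map_mul' := ?_
            map_zero' := ?_
            map_add' := ?_ }, fun r => rfl⟩
  · simp only [QuadraticAlgebra.re_one, QuadraticAlgebra.im_one, map_one, map_zero, zero_mul, add_zero]
  · intro x y
    simp only [QuadraticAlgebra.re_mul, QuadraticAlgebra.im_mul, map_add, map_mul, map_neg, map_one]
    linear_combination -(algebraMap ℚ_[2] L (incl x.im) * algebraMap ℚ_[2] L (incl y.im)) * hτ
  · simp only [QuadraticAlgebra.re_zero, QuadraticAlgebra.im_zero, map_zero, zero_mul, add_zero]
  · intro x y
    simp only [QuadraticAlgebra.re_add, QuadraticAlgebra.im_add, map_add]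
    ring

theorem no_cube (c : ℚ_[2]) (h : c ^ 2 + c + 1 = 0) : False := by
  have h3 : c ^ 3 = 1 := by linear_combination (c - 1) * h
  have hn : ‖c‖ ^ 3 = 1 := by rw [← norm_pow, h3, norm_one]
  have hn1 : ‖c‖ = 1 := (pow_eq_one_iff_of_nonneg (norm_nonneg _) three_ne_zero).mp hn
  obtain ⟨d, rfl, -⟩ := incl_lift c hn1.le
  have e : d ^ 2 + d + 1 = 0 := by
    apply incl_inj
    rw [map_add, map_add, map_pow, map_one, map_zero]
    exact h
  have e2 := congrArg pr e
  simp only [map_add, map_pow, map_one, map_zero] at e2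
  generalize pr d = f at e2
  revert f; decide

theorem indep {L : Type*} [Field L] [Algebra ℚ_[2] L] (τ : L) (hτ : τ ^ 2 = -1 - τ) (a b : ℚ_[2])
    (h : algebraMap ℚ_[2] L a + algebraMap ℚ_[2] L b * τ = 0) : a = 0 ∧ b = 0 := by
  by_cases hb : b = 0
  · subst hb
    simpa using h
  · exfalso
    have hb' : algebraMap ℚ_[2] L b ≠ 0 := by simpa using hb
    apply no_cube (-a / b)
    apply (algebraMap ℚ_[2] L).injective
    have : τ = algebraMap ℚ_[2] L (-a / b) := by
      rw [map_div₀, map_neg, eq_div_iff hb']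
      linear_combination h
    rw [map_add, map_add, map_pow, ← this, map_one, map_zero]
    linear_combination hτ

theorem rep {L : Type*} [Field L] [Algebra ℚ_[2] L] (hdim : Module.finrank ℚ_[2] L = 2)
    (τ : L) (hτ : τ ^ 2 = -1 - τ) (x : L) :
    ∃ a b : ℚ_[2], x = algebraMap ℚ_[2] L a + algebraMap ℚ_[2] L b * τ := by
  have hli : LinearIndependent ℚ_[2] ![(1 : L), τ] := by
    rw [LinearIndependent.pair_iff]
    intro a b h
    apply indep τ hτ
    rw [Algebra.smul_def, Algebra.smul_def, mul_one] at h
    exact h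
  haveI : Module.Finite ℚ_[2] L := Module.finite_of_finrank_pos (by omega)
  have hs := hli.span_eq_top_of_card_eq_finrank' (by simp [hdim])
  have hx : x ∈ Submodule.span ℚ_[2] (Set.range ![(1 : L), τ]) := by rw [hs]; trivial
  rw [Matrix.range_cons, Matrix.range_cons, Matrix.range_empty, Set.union_empty,
    Set.singleton_union, Submodule.mem_span_pair] at hx
  obtain ⟨a, b, h⟩ := hx
  refine ⟨a, b, ?_⟩
  rw [← h, Algebra.smul_def, Algebra.smul_def, mul_one]

theorem scale (a b : ℚ_[2]) (ha : a ≠ 0) (hab : ‖b‖ ≤ ‖a‖) :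
    ∃ n : ℤ, ∃ c d : ℤ_[2], IsUnit c ∧ a = 2 ^ n * incl c ∧ b = 2 ^ n * incl d := by
  have h2 : ‖(2 : ℚ_[2])‖ = 2⁻¹ := by simpa using Padic.norm_p (p := 2)
  have hne : (2 : ℚ_[2]) ^ a.valuation ≠ 0 := zpow_ne_zero _ two_ne_zero
  have hna : ‖(2 : ℚ_[2]) ^ a.valuation‖ = ‖a‖ := by
    rw [norm_zpow, h2, Padic.norm_eq_zpow_neg_valuation ha, zpow_neg, inv_zpow]; norm_num
  have hpos : 0 < ‖a‖ := norm_pos_iff.mpr ha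
  have hc : ‖a / 2 ^ a.valuation‖ = 1 := by rw [norm_div, hna, div_self hpos.ne']
  have hd : ‖b / 2 ^ a.valuation‖ ≤ 1 := by rw [norm_div, hna]; exact (div_le_one hpos).mpr hab
  obtain ⟨c, hc1, hc2⟩ := incl_lift _ hc.le
  obtain ⟨d, hd1, -⟩ := incl_lift _ hd
  refine ⟨a.valuation, c, d, ?_, ?_, ?_⟩
  · rw [PadicInt.isUnit_iff, hc2]; exact hc
  · rw [hc1]; field_simp
  · rw [hd1]; field_simp

theorem dec5 : ∀ c d : ZMod 16, (8 * c ≠ 0 ∨ 8 * d ≠ 0) → 8 * nf c d ≠ 0 := by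
  intro c d h h0
  have := dec0' c d h0
  tauto

theorem prim {L : Type*} [Field L] [Algebra ℚ_[2] L] (hdim : Module.finrank ℚ_[2] L = 2)
    (τ : L) (hτ : τ ^ 2 = -1 - τ) (φ : RR →+* L)
    (hφ : ∀ r : RR, φ r = algebraMap ℚ_[2] L (incl r.re) + algebraMap ℚ_[2] L (incl r.im) * τ)
    (x : L) (hx : x ≠ 0) : ∃ n : ℤ, ∃ r : RR, IsUnit r ∧ x = 2 ^ n * φ r := by
  obtain ⟨a, b, rfl⟩ := rep hdim τ hτ x
  have key : ∃ n : ℤ, ∃ c d : ℤ_[2], (IsUnit c ∨ IsUnit d) ∧ a = 2 ^ n * incl c ∧ b = 2 ^ n * incl d := by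
    rcases le_total ‖b‖ ‖a‖ with h | h
    · have ha : a ≠ 0 := by
        rintro rfl
        rw [norm_zero, norm_le_zero_iff] at h
        subst h
        simp at hx
      obtain ⟨n, c, d, h1, h2, h3⟩ := scale a b ha h
      exact ⟨n, c, d, Or.inl h1, h2, h3⟩
    · have hb : b ≠ 0 := by
        rintro rfl
        rw [norm_zero, norm_le_zero_iff] at h
        subst h
        simp at hx
      obtain ⟨n, c, d, h1, h2, h3⟩ := scale b a hb h
      exact ⟨n, d, c, Or.inr h1, h3, h2⟩
  obtain ⟨n, c, d, h1, h2, h3⟩ := key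
  refine ⟨n, ⟨c, d⟩, ?_, ?_⟩
  · rw [unit_pr, norm_eq, pr_nf]
    apply dec5
    exact h1.imp (pr_of_unit _) (pr_of_unit _)
  · rw [hφ, h2, h3, map_mul, map_mul, map_zpow₀, map_ofNat]; ring

theorem phi_inj {L : Type*} [Field L] [Algebra ℚ_[2] L] 
    (τ : L) (hτ : τ ^ 2 = -1 - τ) (φ : RR →+* L)
    (hφ : ∀ r : RR, φ r = algebraMap ℚ_[2] L (incl r.re) + algebraMap ℚ_[2] L (incl r.im) * τ) :
    Function.Injective φ := by
  rw [injective_iff_map_eq_zero]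
  intro r hr
  rw [hφ] at hr
  obtain ⟨h1, h2⟩ := indep τ hτ _ _ hr
  ext
  · exact incl_inj (h1.trans (map_zero incl).symm)
  · exact incl_inj (h2.trans (map_zero incl).symm)

theorem two_not_unit : ¬ IsUnit (2 : RR) := by
  rw [unit_pr, norm_eq, pr_nf]
  simp only [QuadraticAlgebra.re_ofNat, QuadraticAlgebra.im_ofNat]
  rw [map_ofNat, map_zero]; decide

theorem integral_w {L : Type*} [Field L] [Algebra ℚ_[2] L] (hdim : Module.finrank ℚ_[2] L = 2)
    (τ : L) (hτ : τ ^ 2 = -1 - τ) (φ : RR →+* L)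
    (hφ : ∀ r : RR, φ r = algebraMap ℚ_[2] L (incl r.re) + algebraMap ℚ_[2] L (incl r.im) * τ)
    (m c : RR) (hm : IsUnit m) (w : L) (h : φ m * w ^ 2 = φ c) : ∃ w' : RR, w = φ w' := by
  by_cases hw : w = 0
  · exact ⟨0, by simp [hw]⟩
  have hL2 : (2 : L) ≠ 0 := by
    have := (map_ne_zero (algebraMap ℚ_[2] L)).mpr (two_ne_zero)
    rwa [map_ofNat] at this
  obtain ⟨n, r, hr, rfl⟩ := prim hdim τ hτ φ hφ w hw
  rcases le_or_gt 0 n with hn | hn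
  · lift n to ℕ using hn
    exact ⟨2 ^ n * r, by rw [map_mul, map_pow, map_ofNat, zpow_natCast]⟩
  · exfalso
    obtain ⟨k, rfl⟩ : ∃ k : ℕ, n = -((k : ℤ) + 1) := ⟨(-n - 1).toNat, by omega⟩
    have e : m * r ^ 2 = 2 * ((2 ^ k) ^ 2 * 2 * c) := by
      apply phi_inj τ hτ φ hφ
      have : (2 : L) ^ (-((k : ℤ) + 1)) * 2 ^ (k + 1) = 1 := by
        rw [← zpow_natCast, ← zpow_add₀ hL2]; simp
      simp only [map_mul, map_pow, map_ofNat] 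
      rw [← h]
      generalize (2 : L) ^ (-((k : ℤ) + 1)) = u at *
      rw [pow_succ] at this
      linear_combination (-(φ m * φ r ^ 2) * (u * (2 ^ k * 2) + 1)) * this
    have hu := hm.mul (hr.pow 2)
    rw [e] at hu
    exact two_not_unit (isUnit_of_mul_isUnit_left hu)


theorem no_sol {L : Type*} [Field L] [Algebra ℚ_[2] L] (hdim : Module.finrank ℚ_[2] L = 2)
    (τ : L) (hτ : τ ^ 2 = -1 - τ) (φ : RR →+* L)
    (hφ : ∀ r : RR, φ r = algebraMap ℚ_[2] L (incl r.re) + algebraMap ℚ_[2] L (incl r.im) * τ)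
    (p : ℕ) (hp : p % 8 = 3 ∨ p % 8 = 5) (m : RR) (hm : m.norm = p + 2) (z w : L)
    (h : φ m * w ^ 2 = (1 + φ m * z ^ 2) * (p * (1 + φ m * z ^ 2) + 2)) : False := by
  have hpc := p_cases p hp
  have hL2 : (2 : L) ≠ 0 := by
    have := (map_ne_zero (algebraMap ℚ_[2] L)).mpr (two_ne_zero)
    rwa [map_ofNat] at this
  have hmu : IsUnit m := by
    rw [unit_pr, hm, map_add, map_natCast, map_ofNat]
    rcases hpc with h | h | h | h <;> rw [h] <;> decide
  have inj := phi_inj τ hτ φ hφ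
  have hint : ∀ z' : RR, z = φ z' → False := by
    rintro z' rfl
    have h' : φ m * w ^ 2 = φ ((1 + m * z' ^ 2) * (p * (1 + m * z' ^ 2) + 2)) := by
      rw [h]; simp only [map_mul, map_add, map_one, map_pow, map_natCast, map_ofNat]
    obtain ⟨w', rfl⟩ := integral_w hdim τ hτ φ hφ m _ hmu w h'
    refine no_int p hp m z' w' _ hm rfl (inj ?_)
    rw [← h', map_mul, map_pow]
  by_cases hz : z = 0
  · exact hint 0 (by rw [hz, map_zero])
  obtain ⟨n, r, hr, rfl⟩ := prim hdim τ hτ φ hφ z hz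
  rcases le_or_gt 0 n with hn | hn
  · lift n to ℕ using hn
    exact hint (2 ^ n * r) (by rw [map_mul, map_pow, map_ofNat, zpow_natCast])
  · obtain ⟨k, rfl⟩ : ∃ k : ℕ, n = -((k : ℤ) + 1) := ⟨(-n - 1).toNat, by omega⟩
    obtain ⟨r', hr'⟩ := hr.exists_right_inv
    have e : (2 : L) ^ (-((k : ℤ) + 1)) * 2 ^ (k + 1) = 1 := by
      rw [← zpow_natCast, ← zpow_add₀ hL2]; simp
    have hz1 : ((2 : L) ^ (-((k : ℤ) + 1)) * φ r) * (2 * φ (2 ^ k * r')) = 1 := by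
      have e2 : φ r * φ r' = 1 := by rw [← map_mul, hr', map_one]
      rw [map_mul, map_pow, map_ofNat]
      rw [pow_succ] at e
      linear_combination φ r * φ r' * e + e2
    generalize (2 : L) ^ (-((k : ℤ) + 1)) * φ r = z at *
    generalize 2 ^ k * r' = y at *
    have h' : φ m * (w * (4 * φ y ^ 2)) ^ 2 =
        φ ((4 * y ^ 2 + m) * (p * (4 * y ^ 2 + m) + 8 * y ^ 2)) := by
      simp only [map_mul, map_add, map_pow, map_natCast, map_ofNat]
      have hz2 : z ^ 2 * (4 * φ y ^ 2) = 1 := by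
        linear_combination (z * (2 * φ y) + 1) * hz1
      generalize z ^ 2 = Z at *
      generalize φ y ^ 2 = Y at *
      have h3 : (1 + φ m * Z) * (4 * Y) = 4 * Y + φ m := by linear_combination φ m * hz2
      rw [← h3]
      linear_combination 16 * Y ^ 2 * h
    obtain ⟨w', hw'⟩ := integral_w hdim τ hτ φ hφ m _ hmu _ h'
    rw [hw'] at h'
    refine no_inf p hp m (y ^ 2) w' _ hm rfl (inj ?_)
    rw [← h', map_mul, map_pow]

theorem yes7 {L : Type*} [Field L] (h2 : (2 : L) ≠ 0) (φ : RR →+* L) (k : ℕ) (μ : RR)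
    (hμ0 : φ μ ≠ 0) (hμ : μ.norm = ((8 * k + 9 : ℕ) : ℤ_[2])) :
    ∃ z w : L, φ μ * w ^ 2 = (φ μ + ((8 * k + 7 : ℕ) : L) * z ^ 2) *
      (φ μ + ((8 * k + 9 : ℕ) : L) * z ^ 2) := by
  obtain ⟨v, hv | hv⟩ := pm_sq μ (by
    rw [hμ, map_natCast]; push_cast
    have h16 : (16 : ZMod 16) = 0 := by decide
    linear_combination (k + 1) * h16)
  · refine ⟨0, φ v, ?_⟩
    rw [hv, map_pow]; ring
  · obtain ⟨g, hg⟩ := sq_of_near (1 + 8 * (-8 * (2 * μ + k + 1) ^ 2)) 1 (-8 * (2 * μ + k + 1) ^ 2)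
      isUnit_one (by ring)
    have hv' : φ μ = - φ v ^ 2 := by rw [hv, map_neg, map_pow]
    have hv0 : φ v ≠ 0 := by
      intro h0; apply hμ0; rw [hv', h0]; ring
    have hg' := congrArg φ hg
    simp only [map_mul, map_add, map_pow, map_neg, map_one, map_natCast, map_ofNat] at hg'
    refine ⟨1 / 4, φ g / (φ v * 16), ?_⟩
    have h4 : (4 : L) ≠ 0 := by
      have : (4 : L) = 2 * 2 := by norm_num
      rw [this]; exact mul_ne_zero h2 h2
    have h16 : (16 : L) ≠ 0 := by
      have : (16 : L) = 4 * 4 := by norm_num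
      rw [this]; exact mul_ne_zero h4 h4
    have e : φ μ * (φ g / (φ v * 16)) ^ 2 = - (φ g ^ 2 / 16 ^ 2) := by
      rw [hv']; field_simp
    rw [e, hg']
    push_cast
    field_simp
    ring

theorem yes1 {L : Type*} [Field L] (h2 : (2 : L) ≠ 0) (h3 : (3 : L) ≠ 0)
    (φ : RR →+* L) (k : ℕ) (μ : RR)
    (hμ : μ.norm = ((8 * k + 3 : ℕ) : ℤ_[2])) :
    ∃ z w : L, φ μ * w ^ 2 = (φ μ + ((8 * k + 1 : ℕ) : L) * z ^ 2) *
      (φ μ + ((8 * k + 3 : ℕ) : L) * z ^ 2) := by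
  obtain ⟨A, hA⟩ : ∃ A : RR, A = ⟨1, 2⟩ := ⟨_, rfl⟩
  have hA2 : A ^ 2 = -3 := by
    rw [hA]
    ext
    · simp [pow_two, QuadraticAlgebra.re_ofNat, QuadraticAlgebra.im_ofNat]; norm_num
    · simp [pow_two, QuadraticAlgebra.re_ofNat, QuadraticAlgebra.im_ofNat]; norm_num
  have hAn : A.norm = 3 := by
    rw [hA, norm_eq]; unfold nf; norm_num
  have hAu : IsUnit A := by
    rw [unit_pr, hAn, map_ofNat]; decide
  have hφA2 : φ A ^ 2 = -3 := by rw [← map_pow, hA2, map_neg, map_ofNat]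
  have hφA : φ A ≠ 0 := by
    intro h; rw [h] at hφA2; apply h3; linear_combination hφA2
  obtain ⟨v, hv⟩ := pm_sq (A * μ) (by
    rw [map_mul, hAn, hμ, map_mul, map_natCast, map_ofNat]; push_cast
    have h16 : (16 : ZMod 16) = 0 := by decide
    linear_combination (3 * k + 1) * h16)
  obtain ⟨ε, hε, hv⟩ : ∃ ε : RR, ε ^ 2 = 1 ∧ A * μ = ε * v ^ 2 := by
    rcases hv with hv | hv
    · exact ⟨1, by ring, by rw [hv]; ring⟩
    · exact ⟨-1, by ring, by rw [hv]; ring⟩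
  obtain ⟨h, hh⟩ : ∃ h : RR, h ^ 2 = 9 * (1 + 4 * k) - 24 * ε * A * k * (1 + 2 * k) := by
    rcases Nat.even_or_odd' k with ⟨j, hj | hj⟩
    · refine sq_of_near _ 1 (1 + 9 * j - 3 * ε * A * k * (1 + 2 * k)) isUnit_one ?_
      rw [hj]; push_cast; ring
    · refine sq_of_near _ A (6 + 9 * j - 3 * ε * A * k * (1 + 2 * k)) hAu ?_
      rw [hA2, hj]; push_cast; ring
  have hh' := congrArg φ hh
  have hv' := congrArg φ hv
  have hε' := congrArg φ hε
  simp only [map_mul, map_add, map_sub, map_pow, map_one, map_natCast, map_ofNat] at hh' hv' hε'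
  refine ⟨φ v / φ A, φ v / φ A * (2 * φ h / 3), ?_⟩
  have e : φ μ = φ ε * φ A * (φ v / φ A) ^ 2 := by
    field_simp; linear_combination hv'
  rw [e]
  generalize φ v / φ A = z
  have e2 : φ ε * φ A * (2 * φ h / 3) ^ 2 = (φ ε * φ A + (8 * k + 1)) * (φ ε * φ A + (8 * k + 3)) := by
    have e3 : (2 * φ h / 3) ^ 2 = 4 * φ h ^ 2 / 9 := by
      rw [div_pow]; norm_num; ring
    have h9 : (9 : L) ≠ 0 := by
      have : (9 : L) = 3 * 3 := by norm_num
      rw [this]; exact mul_ne_zero h3 h3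
    rw [e3, hh', ← mul_div_assoc, div_eq_iff h9]
    generalize φ ε = E at *
    generalize φ A = B at *
    linear_combination (-96 * k * (1 + 2 * k) * B ^ 2 - 9 * B ^ 2) * hε'
      + (-96 * k * (1 + 2 * k) - 9) * hφA2
  push_cast
  linear_combination z ^ 4 * e2

end Stmt19

theorem stmt_19 (p q : ℕ) (hp : p.Prime) (hq : q.Prime) (hpo : Odd p) (hqo : Odd q)
    (hpq : q = p + 2) (hp2 : p % 3 = 2)
    (s t : ℤ) (hst : s ^ 2 - s * t + t ^ 2 = (q : ℤ))
    (L : Type*) [Field L] [Algebra ℚ_[2] L] (hdim : Module.finrank ℚ_[2] L = 2)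
    (α : L) (hα : α ^ 2 = -3) (τ : L) (hτ : τ = (-1 + α) / 2)
    (μ : L) (hμ : μ = (s : L) + (t : L) * τ) :
    (∃ z w : L,
        μ * w ^ 2 = μ ^ 2 + ((p : L) + (q : L)) * μ * z ^ 2 + (p : L) * (q : L) * z ^ 4) ↔
      (p % 24 = 17 ∨ p % 24 = 23) := by
  have inj0 := (algebraMap ℚ_[2] L).injective
  haveI : CharZero L := charZero_of_injective_algebraMap inj0
  have h2 : (2 : L) ≠ 0 := two_ne_zero
  have hτ2 : τ ^ 2 = -1 - τ := by
    rw [hτ]; field_simp; linear_combination hα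
  obtain ⟨φ, hφ⟩ := Stmt19.exists_phi τ hτ2
  have hμφ : φ ⟨(s : ℤ_[2]), (t : ℤ_[2])⟩ = μ := by
    rw [hφ, hμ]; simp only [map_intCast]
  have hstZ : (s : ℤ_[2]) ^ 2 - s * t + t ^ 2 = (q : ℤ_[2]) := by exact_mod_cast congrArg (Int.cast : ℤ → ℤ_[2]) hst
  have hn : QuadraticAlgebra.norm (⟨(s : ℤ_[2]), (t : ℤ_[2])⟩ : Stmt19.RR) = (q : ℤ_[2]) := by
    rw [Stmt19.norm_eq, ← hstZ]; rfl
  have hmm : μ * φ ⟨(s - t : ℤ_[2]), (-t : ℤ_[2])⟩ = (q : L) := by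
    have hstL : (s : L) ^ 2 - s * t + t ^ 2 = (q : L) := by exact_mod_cast congrArg (Int.cast : ℤ → L) hst
    rw [hφ, hμ]; simp only [map_intCast, map_sub, map_neg]
    rw [← hstL]
    linear_combination (-(t : L) ^ 2) * hτ2
  have hq0 : (q : L) ≠ 0 := by exact_mod_cast hq.ne_zero
  have hμ0 : μ ≠ 0 := by
    rintro rfl; apply hq0; rw [← hmm, zero_mul]
  have hqL : (q : L) = p + 2 := by rw [hpq]; push_cast; ring
  have hodd : p % 2 = 1 := Nat.odd_iff.mp hpo
  constructor
  · rintro ⟨z, w, h⟩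
    by_contra hcon
    have h8 : p % 8 = 3 ∨ p % 8 = 5 := by omega
    refine Stmt19.no_sol hdim τ hτ2 φ hφ p h8 ⟨(s - t : ℤ_[2]), (-t : ℤ_[2])⟩ ?_ z w ?_
    · have : (p : ℤ_[2]) + 2 = (q : ℤ_[2]) := by rw [hpq]; push_cast; ring
      rw [Stmt19.norm_eq, this, ← hstZ]
      unfold Stmt19.nf
      ring
    · generalize φ ⟨(s - t : ℤ_[2]), (-t : ℤ_[2])⟩ = m at *
      apply mul_left_cancel₀ (pow_ne_zero 2 hμ0)
      rw [hqL] at h hmm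
      have hp' : (p : L) = μ * m - 2 := by rw [hmm]; ring
      rw [hp'] at h ⊢
      linear_combination (μ * m) * h
  · intro h
    have hfac : ∀ z : L, μ ^ 2 + ((p : L) + (q : L)) * μ * z ^ 2 + (p : L) * (q : L) * z ^ 4
      = (μ + p * z ^ 2) * (μ + q * z ^ 2) := by intro z; ring
    simp only [hfac]
    rcases h with h | h
    · obtain ⟨k, hk⟩ : ∃ k, p = 8 * k + 1 := ⟨p / 8, by omega⟩
      have hk' : q = 8 * k + 3 := by omega
      rw [hk'] at hn
      rw [hk', hk, ← hμφ]
      exact Stmt19.yes1 h2 three_ne_zero φ k _ hn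
    · obtain ⟨k, hk⟩ : ∃ k, p = 8 * k + 7 := ⟨p / 8, by omega⟩
      have hk' : q = 8 * k + 9 := by omega
      rw [hk'] at hn
      rw [← hμφ] at hμ0
      rw [hk', hk, ← hμφ]
      exact Stmt19.yes7 h2 φ k _ hμ0 hn
end
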